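/- arXiv:0911.5386 — 4 statements merged into one kernel-verified Lean document; each statement's English description precedes it below -/
import Mathlib

section
/- Assume the quantum Jacobi–Trudi identity T_{λ⊂μ}(u) = det_{1≤i,j≤μ_1}( T^{μ′_i−λ′_j−i+j}(u−μ_1+μ′_1−μ′_i−λ′_j+i+j−1) ) holds for all skew Young diagrams. Then for all integers a, m ≥ 1: T_m^a(u−1)·T_m^a(u+1) = T_{m+1}^a(u)·T_{m−1}^a(u) + g_m^a(u)·T_m^{a−1}(u)·T_m^{a+1}(u), where g_m^1(u) := ∏_{j=1}^{m} P_1(u−m+2j−2) for m ≥ 1 and g_m^a(u) := 1 for a ≥ 2, and the boundary conventions T_m^0(u) = 1 (m ≥ 0) and T_0^a(u) = 1 (a ≥ 0) are used. -/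
/-!
Analytic Bethe ansatz for the Lie superalgebra `sl(r+1|s+1)` (Z. Tsuboi,
J. Phys. A: Math. Gen. 30 (1997) 7975-7991).  Common definitions.
-/

open scoped Classical
open Filter Topology

noncomputable section

namespace Tsuboi

/-- The bracket `[u] = sinh(ηu)/sinh(η)`. -/
def br (η u : ℂ) : ℂ := Complex.sinh (η * u) / Complex.sinh η

/-- `P₁(u) = ∏_{j=1}^{N} [u - w_j]`. -/
def Pf (η : ℂ) (N : ℕ) (w : ℕ → ℂ) (u : ℂ) : ℂ :=
  ∏ j ∈ Finset.range N, br η (u - w j)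

/-- `Q_a(u) = ∏_{j=1}^{N_a} [u - u_j^{(a)}]`, with the conventions
`Q_0 = Q_{r+s+2} = 1`. -/
def Qf (r s : ℕ) (η : ℂ) (Nb : ℕ → ℕ) (rt : ℕ → ℕ → ℂ) (a : ℕ) (u : ℂ) : ℂ :=
  if a = 0 ∨ a = r + s + 2 then 1
  else ∏ j ∈ Finset.range (Nb a), br η (u - rt a j)

/-- The vacuum factor `ψ_a(u)`. -/
def ψf (η : ℂ) (N : ℕ) (w : ℕ → ℂ) (a : ℕ) (u : ℂ) : ℂ :=
  if a = 1 then Pf η N w (u + 2) else Pf η N w u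

/-- The box function `z(a;u)`, for `a ∈ J = {1,…,r+s+2}` (first branch `J₊`,
second branch `J₋`). -/
def zf (r s : ℕ) (η : ℂ) (Nb : ℕ → ℕ) (rt : ℕ → ℕ → ℂ) (N : ℕ) (w : ℕ → ℂ)
    (a : ℕ) (u : ℂ) : ℂ :=
  if a ≤ r + 1 then
    ψf η N w a u * Qf r s η Nb rt (a - 1) (u + a + 1) * Qf r s η Nb rt a (u + a - 2) /
      (Qf r s η Nb rt (a - 1) (u + a - 1) * Qf r s η Nb rt a (u + a))
  else
    ψf η N w a u * Qf r s η Nb rt (a - 1) (u + 2 * r - a + 1) *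
        Qf r s η Nb rt a (u + 2 * r - a + 4) /
      (Qf r s η Nb rt (a - 1) (u + 2 * r - a + 3) * Qf r s η Nb rt a (u + 2 * r - a + 2))

/-- The sign `(-1)^{p(a)}` for `a ∈ J`. -/
def sgn (r : ℕ) (a : ℕ) : ℂ := if a ≤ r + 1 then 1 else -1

/-- The denominator of `z(a;u)`. -/
def zDen (r s : ℕ) (η : ℂ) (Nb : ℕ → ℕ) (rt : ℕ → ℕ → ℂ) (a : ℕ) (u : ℂ) : ℂ :=
  if a ≤ r + 1 then
    Qf r s η Nb rt (a - 1) (u + a - 1) * Qf r s η Nb rt a (u + a)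
  else
    Qf r s η Nb rt (a - 1) (u + 2 * r - a + 3) * Qf r s η Nb rt a (u + 2 * r - a + 2)

/-- The pairing `(α_a|α_b)` for the distinguished simple roots of `sl(r+1|s+1)`. -/
def cart (r : ℕ) (a b : ℕ) : ℤ :=
  if a = b then (if a ≤ r then 2 else if a = r + 1 then 0 else -2)
  else if b = a + 1 ∨ a = b + 1 then (if min a b ≤ r then -1 else 1)
  else 0

/-- The Bethe ansatz equations for the distinguished simple root system, with
quantum space labelled by the Young diagram `(1)`. -/
def BAE (r s : ℕ) (η : ℂ) (Nb : ℕ → ℕ) (rt : ℕ → ℕ → ℂ) (N : ℕ) (w : ℕ → ℂ) : Prop :=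
  ∀ a ∈ Finset.Icc 1 (r + s + 1), ∀ k < Nb a,
    -((if a = 1 then Pf η N w (rt a k + (if a ≤ r + 1 then 1 else -1)) else 1) /
        (if a = 1 then Pf η N w (rt a k - (if a ≤ r + 1 then 1 else -1)) else 1)) =
      (if a = r + 1 then -1 else 1) *
        ∏ b ∈ Finset.Icc 1 (r + s + 1),
          Qf r s η Nb rt b (rt a k + (cart r a b : ℂ)) /
            Qf r s η Nb rt b (rt a k - (cart r a b : ℂ))

/-- Genericity of the Bethe roots: no two of the (shifted) roots collide with
each other (so all poles of the `z`-functions are simple) and the roots stay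
away from the inhomogeneities `w_i` (no other factor vanishes at a pole). -/
def Generic (r s : ℕ) (η : ℂ) (Nb : ℕ → ℕ) (rt : ℕ → ℕ → ℂ) (N : ℕ) (w : ℕ → ℂ) : Prop :=
  (∀ c ∈ Finset.Icc 1 (r + s + 1), ∀ c' ∈ Finset.Icc 1 (r + s + 1),
      ∀ j < Nb c, ∀ j' < Nb c', ∀ m : ℤ,
        ((c, j) ≠ (c', j') ∨ m ≠ 0) → br η (rt c j - rt c' j' + (m : ℂ)) ≠ 0) ∧
  (∀ c ∈ Finset.Icc 1 (r + s + 1), ∀ j < Nb c, ∀ i < N, ∀ m : ℤ,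
      br η (rt c j - w i + (m : ℂ)) ≠ 0)

/-- A skew Young diagram `λ ⊂ μ` (rows indexed from 1, at most `d` nonempty rows). -/
structure Skew where
  lam : ℕ → ℕ
  mu : ℕ → ℕ
  d : ℕ
  sub : ∀ i, lam i ≤ mu i
  lam_anti : ∀ i j, 1 ≤ i → i ≤ j → lam j ≤ lam i
  mu_anti : ∀ i j, 1 ≤ i → i ≤ j → mu j ≤ mu i
  bound : ∀ i, d < i → mu i = 0

/-- `(i,j)` is a cell of the skew diagram `μ∖λ`. -/
def Skew.cell (D : Skew) (i j : ℕ) : Prop := 1 ≤ i ∧ D.lam i < j ∧ j ≤ D.mu i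

/-- The conjugate partition `μ′`. -/
def Skew.conjMu (D : Skew) (j : ℕ) : ℕ :=
  ((Finset.Icc 1 D.d).filter fun i => j ≤ D.mu i).card

/-- The conjugate partition `λ′`. -/
def Skew.conjLam (D : Skew) (j : ℕ) : ℕ :=
  ((Finset.Icc 1 D.d).filter fun i => j ≤ D.lam i).card

/-- Admissibility of a tableau on the skew diagram `λ ⊂ μ`:  entries (the value
at a cell `(i,j)` is `t (i-1, j-1) + 1 ∈ J`) weakly increase along rows and
columns, entries from `J₊` strictly increase down columns, entries from `J₋`
strictly increase along rows; off-cell values are normalised to `0`. -/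
def Adm (r s : ℕ) (D : Skew) (t : Fin D.d × Fin (D.mu 1) → Fin (r + s + 2)) : Prop :=
  (∀ p, ¬ D.cell (p.1.1 + 1) (p.2.1 + 1) → (t p : ℕ) = 0) ∧
  ∀ p q, D.cell (p.1.1 + 1) (p.2.1 + 1) → D.cell (q.1.1 + 1) (q.2.1 + 1) →
    ((q.1.1 = p.1.1 ∧ q.2.1 = p.2.1 + 1 →
        (t p : ℕ) ≤ (t q : ℕ) ∧ (r + 2 ≤ (t p : ℕ) + 1 → (t p : ℕ) < (t q : ℕ))) ∧
     (q.1.1 = p.1.1 + 1 ∧ q.2.1 = p.2.1 →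
        (t p : ℕ) ≤ (t q : ℕ) ∧ ((t p : ℕ) + 1 ≤ r + 1 → (t p : ℕ) < (t q : ℕ))))

/-- The normalisation function `F^a(u)` (for `a ≥ 0`). -/
def Fa (η : ℂ) (N : ℕ) (w : ℕ → ℂ) (a : ℕ) (u : ℂ) : ℂ :=
  if a = 0 then 1 / Pf η N w (u - 1)
  else ∏ j ∈ Finset.Icc 1 (a - 1), Pf η N w (u - 2 * (j : ℂ) + (a : ℂ) - 1)

/-- The normalisation `F_{λ⊂μ}(u)`. -/
def Fskew (η : ℂ) (N : ℕ) (w : ℕ → ℂ) (D : Skew) (u : ℂ) : ℂ :=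
  ∏ j ∈ Finset.Icc 1 (D.mu 1),
    Fa η N w (D.conjMu j - D.conjLam j)
      (u + (D.conjMu 1 : ℂ) - (D.mu 1 : ℂ) - (D.conjMu j : ℂ) - (D.conjLam j : ℂ)
        + 2 * (j : ℂ) - 1)

/-- The dressed-vacuum-form eigenvalue `𝒯_{λ⊂μ}(u)`, a sum over the admissible
tableaux on `λ ⊂ μ`. -/
def Tskew (r s : ℕ) (η : ℂ) (Nb : ℕ → ℕ) (rt : ℕ → ℕ → ℂ) (N : ℕ) (w : ℕ → ℂ)
    (D : Skew) (u : ℂ) : ℂ :=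
  (Fskew η N w D u)⁻¹ *
    ∑ t ∈ Finset.univ.filter (Adm r s D),
      ∏ p : Fin D.d × Fin (D.mu 1),
        if D.cell (p.1.1 + 1) (p.2.1 + 1) then
          sgn r ((t p : ℕ) + 1) *
            zf r s η Nb rt N w ((t p : ℕ) + 1)
              (u - (D.mu 1 : ℂ) + (D.conjMu 1 : ℂ) - 2 * ((p.1.1 : ℂ) + 1)
                + 2 * ((p.2.1 : ℂ) + 1))
        else 1

/-- The rectangular diagram `(m^a)` (`a` rows, `m` columns). -/
def rect (a m : ℕ) : Skew where
  lam := fun _ => 0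
  mu := fun i => if 1 ≤ i ∧ i ≤ a then m else 0
  d := a
  sub := fun _ => Nat.zero_le _
  lam_anti := fun _ _ _ _ => le_rfl
  mu_anti := by
    intro i j hi hij
    by_cases hj : 1 ≤ j ∧ j ≤ a
    · have hi' : 1 ≤ i ∧ i ≤ a := ⟨hi, le_trans hij hj.2⟩
      simp [hj, hi']
    · simp only [if_neg hj]
      exact Nat.zero_le _
  bound := by
    intro i hi
    have h : ¬ (1 ≤ i ∧ i ≤ a) := by omega
    simp [h]

/-- `𝒯_m^a(u) = 𝒯_{(m^a)}(u)`. -/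
def Trect (r s : ℕ) (η : ℂ) (Nb : ℕ → ℕ) (rt : ℕ → ℕ → ℂ) (N : ℕ) (w : ℕ → ℂ)
    (a m : ℕ) (u : ℂ) : ℂ :=
  Tskew r s η Nb rt N w (rect a m) u

/-- `𝒯^a(u)` for `a : ℤ`:  `𝒯^a = 𝒯_{(1^a)}` for `a ≥ 1`, `𝒯^0(u) = P_1(u-1)`,
`𝒯^a = 0` for `a < 0`. -/
def TaA (r s : ℕ) (η : ℂ) (Nb : ℕ → ℕ) (rt : ℕ → ℕ → ℂ) (N : ℕ) (w : ℕ → ℂ)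
    (a : ℤ) (u : ℂ) : ℂ :=
  if a < 0 then 0
  else if a = 0 then Pf η N w (u - 1)
  else Tskew r s η Nb rt N w (rect a.toNat 1) u

/-- `𝒯_m(u)` for `m : ℤ`:  `𝒯_m = 𝒯_{(m)}` for `m ≥ 1`, `𝒯_0 = 1`,
`𝒯_m = 0` for `m < 0`. -/
def TmA (r s : ℕ) (η : ℂ) (Nb : ℕ → ℕ) (rt : ℕ → ℕ → ℂ) (N : ℕ) (w : ℕ → ℂ)
    (m : ℤ) (u : ℂ) : ℂ :=
  if m < 0 then 0
  else if m = 0 then 1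
  else Tskew r s η Nb rt N w (rect 1 m.toNat) u

/-- The quantum Jacobi–Trudi identity (column form) for all skew diagrams. -/
def JTcol (r s : ℕ) (η : ℂ) (Nb : ℕ → ℕ) (rt : ℕ → ℕ → ℂ) (N : ℕ) (w : ℕ → ℂ) : Prop :=
  ∀ (D : Skew) (u : ℂ),
    Tskew r s η Nb rt N w D u =
      Matrix.det (Matrix.of fun i j : Fin (D.mu 1) =>
        TaA r s η Nb rt N w
          ((D.conjMu (i.1 + 1) : ℤ) - (D.conjLam (j.1 + 1) : ℤ) - (i.1 + 1) + (j.1 + 1))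
          (u - (D.mu 1 : ℂ) + (D.conjMu 1 : ℂ) - (D.conjMu (i.1 + 1) : ℂ)
            - (D.conjLam (j.1 + 1) : ℂ) + ((i.1 : ℂ) + 1) + ((j.1 : ℂ) + 1) - 1))

/-- `g_m^a(u)`. -/
def gfun (η : ℂ) (N : ℕ) (w : ℕ → ℂ) (a m : ℕ) (u : ℂ) : ℂ :=
  if a = 1 then ∏ j ∈ Finset.Icc 1 m, Pf η N w (u - (m : ℂ) + 2 * (j : ℂ) - 2) else 1

/-- Weakly increasing sequences in `J` with no repeated entry from `J₊`
(the entry at `i` is `b i + 1 ∈ J`). -/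
def IncSeqCol (r s a : ℕ) (b : Fin a → Fin (r + s + 2)) : Prop :=
  ∀ (i : ℕ) (h : i + 1 < a),
    (b ⟨i, by omega⟩ : ℕ) ≤ (b ⟨i + 1, h⟩ : ℕ) ∧
    ((b ⟨i, by omega⟩ : ℕ) + 1 ≤ r + 1 → (b ⟨i, by omega⟩ : ℕ) < (b ⟨i + 1, h⟩ : ℕ))

/-- Weakly increasing sequences in `J` with no repeated entry from `J₋`. -/
def IncSeqRow (r s m : ℕ) (b : Fin m → Fin (r + s + 2)) : Prop :=
  ∀ (i : ℕ) (h : i + 1 < m),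
    (b ⟨i, by omega⟩ : ℕ) ≤ (b ⟨i + 1, h⟩ : ℕ) ∧
    (r + 2 ≤ (b ⟨i, by omega⟩ : ℕ) + 1 → (b ⟨i, by omega⟩ : ℕ) < (b ⟨i + 1, h⟩ : ℕ))

/-- `ℱ^a(u)·𝒯^a(u) = Σ_{b_1 ≼ … ≼ b_a} ∏_i (−1)^{p(b_i)} z(b_i; u+a+1−2i)`. -/
def colSum (r s : ℕ) (η : ℂ) (Nb : ℕ → ℕ) (rt : ℕ → ℕ → ℂ) (N : ℕ) (w : ℕ → ℂ)
    (a : ℕ) (u : ℂ) : ℂ :=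
  ∑ b ∈ Finset.univ.filter (IncSeqCol r s a),
    ∏ i : Fin a,
      sgn r ((b i : ℕ) + 1) *
        zf r s η Nb rt N w ((b i : ℕ) + 1) (u + (a : ℂ) + 1 - 2 * ((i.1 : ℂ) + 1))

/-- `𝒯_m(u) = Σ_{b_1 ≼ … ≼ b_m} ∏_j (−1)^{p(b_j)} z(b_j; u−m−1+2j)`. -/
def rowSum (r s : ℕ) (η : ℂ) (Nb : ℕ → ℕ) (rt : ℕ → ℕ → ℂ) (N : ℕ) (w : ℕ → ℂ)
    (m : ℕ) (u : ℂ) : ℂ :=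
  ∑ b ∈ Finset.univ.filter (IncSeqRow r s m),
    ∏ j : Fin m,
      sgn r ((b j : ℕ) + 1) *
        zf r s η Nb rt N w ((b j : ℕ) + 1) (u - (m : ℂ) - 1 + 2 * ((j.1 : ℂ) + 1))

end Tsuboi

namespace Tsuboi

open Matrix in
/-- Bordered-minor form of the Desnanot–Jacobi identity, for an invertible core block. -/
theorem det_mul_det_toBlocks₁₁_of_ne_zero {m K : Type*} [Fintype m] [DecidableEq m] [Field K]
    (A : Matrix (m ⊕ Fin 2) (m ⊕ Fin 2) K) (hA : A.toBlocks₁₁.det ≠ 0) :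
    A.det * A.toBlocks₁₁.det =
      (A.submatrix (Sum.map id fun _ : Unit => 0) (Sum.map id fun _ : Unit => 0)).det *
          (A.submatrix (Sum.map id fun _ : Unit => 1) (Sum.map id fun _ : Unit => 1)).det -
        (A.submatrix (Sum.map id fun _ : Unit => 0) (Sum.map id fun _ : Unit => 1)).det *
          (A.submatrix (Sum.map id fun _ : Unit => 1) (Sum.map id fun _ : Unit => 0)).det := by
  let : Invertible A.toBlocks₁₁ := A.toBlocks₁₁.invertibleOfIsUnitDet (isUnit_iff_ne_zero.2 hA)
  have minor (i j : Fin 2) :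
      (A.submatrix (Sum.map id fun _ : Unit => i) (Sum.map id fun _ : Unit => j)).det =
        A.toBlocks₁₁.det *
          (A.toBlocks₂₂ - A.toBlocks₂₁ * ⅟A.toBlocks₁₁ * A.toBlocks₁₂) i j := by
    have h : A.submatrix (Sum.map id fun _ : Unit => i) (Sum.map id fun _ : Unit => j) =
        fromBlocks A.toBlocks₁₁ (A.toBlocks₁₂.submatrix id fun _ => j)
          (A.toBlocks₂₁.submatrix (fun _ => i) id)
          (A.toBlocks₂₂.submatrix (fun _ => i) fun _ => j) := by
      ext (x | x) (y | y) <;> rfl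
    rw [h, det_fromBlocks₁₁, det_unique (n := Unit)]
    rfl
  have hdet : A.det = A.toBlocks₁₁.det *
      (A.toBlocks₂₂ - A.toBlocks₂₁ * ⅟A.toBlocks₁₁ * A.toBlocks₁₂).det := by
    conv_lhs => rw [← fromBlocks_toBlocks A, det_fromBlocks₁₁]
  rw [hdet, minor, minor, minor, minor, det_fin_two]
  ring

open Matrix in
/-- Bordered-minor form of the Desnanot–Jacobi identity. -/
theorem det_mul_det_toBlocks₁₁ {m K : Type*} [Fintype m] [DecidableEq m] [Field K]
    (A : Matrix (m ⊕ Fin 2) (m ⊕ Fin 2) K) :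
    A.det * A.toBlocks₁₁.det =
      (A.submatrix (Sum.map id fun _ : Unit => 0) (Sum.map id fun _ : Unit => 0)).det *
          (A.submatrix (Sum.map id fun _ : Unit => 1) (Sum.map id fun _ : Unit => 1)).det -
        (A.submatrix (Sum.map id fun _ : Unit => 0) (Sum.map id fun _ : Unit => 1)).det *
          (A.submatrix (Sum.map id fun _ : Unit => 1) (Sum.map id fun _ : Unit => 0)).det := by
  -- Perturb the core block by the indeterminate to make it invertible.
  let P : Matrix (m ⊕ Fin 2) (m ⊕ Fin 2) (Polynomial K) :=
    fromBlocks (charmatrix (-A.toBlocks₁₁)) (A.toBlocks₁₂.map Polynomial.C)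
      (A.toBlocks₂₁.map Polynomial.C) (A.toBlocks₂₂.map Polynomial.C)
  let φ : Polynomial K →+* FractionRing (Polynomial K) := algebraMap _ _
  have hφ : Function.Injective φ := IsFractionRing.injective _ _
  have hP : (φ.mapMatrix P).toBlocks₁₁.det ≠ 0 := by
    have h : (φ.mapMatrix P).toBlocks₁₁ = φ.mapMatrix (charmatrix (-A.toBlocks₁₁)) := by
      ext; rfl
    rw [h, ← RingHom.map_det]
    exact (map_ne_zero_iff φ hφ).2 (charpoly_monic (-A.toBlocks₁₁)).ne_zero
  have key := det_mul_det_toBlocks₁₁_of_ne_zero (φ.mapMatrix P) hP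
  have key' : P.det * P.toBlocks₁₁.det = _ := hφ (a₂ :=
      (P.submatrix (Sum.map id fun _ : Unit => 0) (Sum.map id fun _ : Unit => 0)).det *
          (P.submatrix (Sum.map id fun _ : Unit => 1) (Sum.map id fun _ : Unit => 1)).det -
        (P.submatrix (Sum.map id fun _ : Unit => 0) (Sum.map id fun _ : Unit => 1)).det *
          (P.submatrix (Sum.map id fun _ : Unit => 1) (Sum.map id fun _ : Unit => 0)).det) <| by
    simp only [map_mul, map_sub, RingHom.map_det]
    exact key
  have hA : (Polynomial.evalRingHom (0 : K)).mapMatrix P = A := by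
    ext (i | i) (j | j)
    · by_cases hij : i = j
      · subst hij
        simp [P, toBlocks₁₁]
      · simp [P, toBlocks₁₁, hij]
    · simp [P, toBlocks₁₂]
    · simp [P, toBlocks₂₁]
    · simp [P, toBlocks₂₂]
  have h0 := congrArg (Polynomial.evalRingHom (0 : K)) key'
  simp only [map_mul, map_sub, RingHom.map_det] at h0
  rw [← hA]
  exact h0

open Matrix in
theorem det_submatrix_mul_det_submatrix_swap {n m R : Type*} [Fintype n] [DecidableEq n]
    [Fintype m] [DecidableEq m] [CommRing R] (A B : Matrix m m R) (e f : n ≃ m) :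
    (A.submatrix e f).det * (B.submatrix f e).det = A.det * B.det := by
  have hA : A.submatrix e f = (A.submatrix f f).submatrix (e.trans f.symm) id := by
    ext; simp
  have hB : B.submatrix f e = (B.submatrix f f).submatrix id (e.trans f.symm) := by
    ext; simp
  have hs : ((Equiv.Perm.sign (e.trans f.symm) : ℤ) : R) *
      ((Equiv.Perm.sign (e.trans f.symm) : ℤ) : R) = 1 := by
    rw [← Int.cast_mul, ← Units.val_mul, Int.units_mul_self]
    simp
  rw [hA, hB, det_permute, det_permute', det_submatrix_equiv_self, det_submatrix_equiv_self]
  linear_combination A.det * B.det * hs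

open Matrix in
/-- The **Desnanot–Jacobi identity** (Dodgson condensation). -/
theorem desnanot_jacobi {K : Type*} [Field K] {n : ℕ} (A : Matrix (Fin (n + 2)) (Fin (n + 2)) K) :
    (A.submatrix Fin.castSucc Fin.castSucc).det * (A.submatrix Fin.succ Fin.succ).det =
      A.det * (A.submatrix (fun i : Fin n => i.castSucc.succ) fun i => i.castSucc.succ).det +
        (A.submatrix Fin.succ Fin.castSucc).det * (A.submatrix Fin.castSucc Fin.succ).det := by
  let g : Fin n ⊕ Fin 2 → Fin (n + 2) :=
    Sum.elim (fun i => i.castSucc.succ) ![0, Fin.last _]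
  let gF : Fin n ⊕ Unit → Fin (n + 1) := Sum.elim Fin.succ fun _ => 0
  let gL : Fin n ⊕ Unit → Fin (n + 1) := Sum.elim Fin.castSucc fun _ => Fin.last _
  have hg : Function.Bijective g := by
    rw [Fintype.bijective_iff_injective_and_card]
    refine ⟨?_, by simp⟩
    rintro (i | i) (j | j) h
    · simpa [g] using h
    · fin_cases j
      · exact (Fin.succ_ne_zero (i.castSucc) h).elim
      · exact (i.castSucc_ne_last (Fin.succ_injective _ h)).elim
    · fin_cases i
      · exact (Fin.succ_ne_zero (j.castSucc) h.symm).elim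
      · exact (j.castSucc_ne_last (Fin.succ_injective _ h.symm)).elim
    · fin_cases i <;> fin_cases j
      · rfl
      · exact (Fin.succ_ne_zero (Fin.last n) h.symm).elim
      · exact (Fin.succ_ne_zero (Fin.last n) h).elim
      · rfl
  have hF : Function.Bijective gF := by
    rw [Fintype.bijective_iff_injective_and_card]
    refine ⟨?_, by simp⟩
    rintro (i | i) (j | j) h <;> simp_all [gF, Fin.ext_iff]
  have hL : Function.Bijective gL := by
    rw [Fintype.bijective_iff_injective_and_card]
    refine ⟨?_, by simp⟩
    rintro (i | i) (j | j) h <;> simp [gL, Fin.ext_iff] at h ⊢ <;> omega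
  let e := Equiv.ofBijective g hg
  let eF := Equiv.ofBijective gF hF
  let eL := Equiv.ofBijective gL hL
  have h0 : g ∘ Sum.map id (fun _ : Unit => 0) = Fin.castSucc ∘ gF := by
    ext (x | x) <;> simp [g, gF]
  have h1 : g ∘ Sum.map id (fun _ : Unit => 1) = Fin.succ ∘ gL := by
    ext (x | x) <;> simp [g, gL]
  have key := det_mul_det_toBlocks₁₁ (A.submatrix g g)
  simp only [submatrix_submatrix, h0, h1] at key
  have hdet : (A.submatrix g g).det = A.det := det_submatrix_equiv_self e A
  have hcore : (A.submatrix g g).toBlocks₁₁ =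
      A.submatrix (fun i : Fin n => i.castSucc.succ) fun i => i.castSucc.succ := rfl
  have h00 : (A.submatrix (Fin.castSucc ∘ gF) (Fin.castSucc ∘ gF)).det =
      (A.submatrix Fin.castSucc Fin.castSucc).det :=
    det_submatrix_equiv_self eF (A.submatrix Fin.castSucc Fin.castSucc)
  have h11 : (A.submatrix (Fin.succ ∘ gL) (Fin.succ ∘ gL)).det =
      (A.submatrix Fin.succ Fin.succ).det :=
    det_submatrix_equiv_self eL (A.submatrix Fin.succ Fin.succ)
  have h01 : (A.submatrix (Fin.castSucc ∘ gF) (Fin.succ ∘ gL)).det *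
      (A.submatrix (Fin.succ ∘ gL) (Fin.castSucc ∘ gF)).det =
      (A.submatrix Fin.castSucc Fin.succ).det * (A.submatrix Fin.succ Fin.castSucc).det :=
    det_submatrix_mul_det_submatrix_swap (A.submatrix Fin.castSucc Fin.succ)
      (A.submatrix Fin.succ Fin.castSucc) eF eL
  rw [hdet, hcore, h00, h11, h01] at key
  linear_combination -key

section RectangularDiagrams

variable {r s : ℕ} {η : ℂ} {Nb : ℕ → ℕ} {rt : ℕ → ℕ → ℂ} {N : ℕ} {w : ℕ → ℂ}

/-- The matrix of `𝒯^{a-i+j}(v+i+j)`, indexed from zero. -/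
def rectMatrix (r s : ℕ) (η : ℂ) (Nb : ℕ → ℕ) (rt : ℕ → ℕ → ℂ) (N : ℕ) (w : ℕ → ℂ)
    (a : ℤ) (m : ℕ) (v : ℂ) : Matrix (Fin m) (Fin m) ℂ :=
  Matrix.of fun i j => TaA r s η Nb rt N w (a - i.1 + j.1) (v + i.1 + j.1)

theorem Trect_eq_det (hJT : JTcol r s η Nb rt N w) {a : ℕ} (ha : 1 ≤ a) (m : ℕ) (u : ℂ) :
    Trect r s η Nb rt N w a m u =
      (rectMatrix r s η Nb rt N w a m (u - m + 1)).det := by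
  have hmu : (rect a m).mu 1 = m := by simp [rect, ha]
  have hconj (j : ℕ) (hj : j < m) : (rect a m).conjMu (j + 1) = a := by
    have : (Finset.Icc 1 (rect a m).d).filter (fun i => j + 1 ≤ (rect a m).mu i) =
        Finset.Icc 1 a := by
      refine Finset.filter_true_of_mem fun i hi => ?_
      exact hj.trans_eq (if_pos (Finset.mem_Icc.1 hi)).symm
    rw [Skew.conjMu, this, Nat.card_Icc, Nat.add_sub_cancel]
  have hlam (j : ℕ) : (rect a m).conjLam (j + 1) = 0 := by
    simp [Skew.conjLam, rect]
  rw [Trect, hJT]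
  let e : Fin m ≃ Fin ((rect a m).mu 1) := finCongr hmu.symm
  rw [← Matrix.det_submatrix_equiv_self e]
  congr 1
  ext i j
  have hi := hconj i.1 i.2
  have hj := hconj j.1 j.2
  have h0 := hconj 0 (i.pos)
  simp only [rectMatrix, Matrix.submatrix_apply, Matrix.of_apply, e, finCongr_apply,
    Fin.val_cast, hi, hlam, hmu]
  rw [zero_add] at h0
  rw [h0]
  congr 1
  · push_cast
    ring
  · push_cast
    ring

theorem Trect_zero_left (m : ℕ) (u : ℂ) : Trect r s η Nb rt N w 0 m u = 1 := by
  have hmu : (rect 0 m).mu 1 = 0 := by simp [rect]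
  have : IsEmpty (Fin (rect 0 m).d × Fin ((rect 0 m).mu 1)) := by
    rw [hmu]; infer_instance
  have hA : ∀ t, Adm r s (rect 0 m) t := fun t => ⟨isEmptyElim, isEmptyElim⟩
  simp [Trect, Tskew, Fskew, hA, hmu]

theorem det_rectMatrix_zero (m : ℕ) (u : ℂ) :
    (rectMatrix r s η Nb rt N w 0 m (u - m + 1)).det = gfun η N w 1 m u := by
  rw [Matrix.det_of_isUpperTriangular]
  · rw [gfun, if_pos rfl, ← Finset.Ico_add_one_right_eq_Icc, Finset.prod_Ico_eq_prod_range,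
      Nat.add_sub_cancel, Finset.prod_range]
    refine Finset.prod_congr rfl fun i _ => ?_
    simp only [rectMatrix, Matrix.of_apply, TaA]
    rw [if_neg (by omega), if_pos (by omega)]
    congr 1
    push_cast
    ring
  · intro i j hij
    have hij' : j.1 < i.1 := hij
    simp only [rectMatrix, Matrix.of_apply, TaA]
    rw [if_pos (by omega)]

theorem rectMatrix_T_system (a : ℤ) (n : ℕ) (v : ℂ) :
    (rectMatrix r s η Nb rt N w a (n + 1) v).det *
        (rectMatrix r s η Nb rt N w a (n + 1) (v + 2)).det =
      (rectMatrix r s η Nb rt N w a (n + 2) v).det *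
          (rectMatrix r s η Nb rt N w a n (v + 2)).det +
        (rectMatrix r s η Nb rt N w (a - 1) (n + 1) (v + 1)).det *
          (rectMatrix r s η Nb rt N w (a + 1) (n + 1) (v + 1)).det := by
  have key := desnanot_jacobi (rectMatrix r s η Nb rt N w a (n + 2) v)
  have h00 : (rectMatrix r s η Nb rt N w a (n + 2) v).submatrix Fin.castSucc Fin.castSucc =
      rectMatrix r s η Nb rt N w a (n + 1) v := rfl
  have h11 : (rectMatrix r s η Nb rt N w a (n + 2) v).submatrix Fin.succ Fin.succ =
      rectMatrix r s η Nb rt N w a (n + 1) (v + 2) := by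
    ext i j
    simp only [rectMatrix, Matrix.submatrix_apply, Matrix.of_apply, Fin.val_succ]
    congr 1 <;> push_cast <;> ring
  have hcore : (rectMatrix r s η Nb rt N w a (n + 2) v).submatrix
      (fun i : Fin n => i.castSucc.succ) (fun i => i.castSucc.succ) =
      rectMatrix r s η Nb rt N w a n (v + 2) := by
    ext i j
    simp only [rectMatrix, Matrix.submatrix_apply, Matrix.of_apply, Fin.val_succ,
      Fin.val_castSucc]
    congr 1 <;> push_cast <;> ring
  have h10 : (rectMatrix r s η Nb rt N w a (n + 2) v).submatrix Fin.succ Fin.castSucc =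
      rectMatrix r s η Nb rt N w (a - 1) (n + 1) (v + 1) := by
    ext i j
    simp only [rectMatrix, Matrix.submatrix_apply, Matrix.of_apply, Fin.val_succ,
      Fin.val_castSucc]
    congr 1 <;> push_cast <;> ring
  have h01 : (rectMatrix r s η Nb rt N w a (n + 2) v).submatrix Fin.castSucc Fin.succ =
      rectMatrix r s η Nb rt N w (a + 1) (n + 1) (v + 1) := by
    ext i j
    simp only [rectMatrix, Matrix.submatrix_apply, Matrix.of_apply, Fin.val_succ,
      Fin.val_castSucc]
    congr 1 <;> push_cast <;> ring
  rwa [h00, h11, hcore, h10, h01] at key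

end RectangularDiagrams

/-- Assuming the quantum Jacobi–Trudi identity, the T-system
(Hirota bilinear difference equation) holds:  for all `a, m ≥ 1`,
`𝒯_m^a(u−1)𝒯_m^a(u+1) = 𝒯_{m+1}^a(u)𝒯_{m−1}^a(u) + g_m^a(u)𝒯_m^{a−1}(u)𝒯_m^{a+1}(u)`. -/
theorem T_system
    (r s : ℕ) (η : ℂ) (hη : Complex.exp (2 * η) ≠ 1)
    (Nb : ℕ → ℕ) (rt : ℕ → ℕ → ℂ) (N : ℕ) (w : ℕ → ℂ)
    (hJT : JTcol r s η Nb rt N w)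
    (a m : ℕ) (ha : 1 ≤ a) (hm : 1 ≤ m) (u : ℂ) :
    Trect r s η Nb rt N w a m (u - 1) * Trect r s η Nb rt N w a m (u + 1) =
      Trect r s η Nb rt N w a (m + 1) u * Trect r s η Nb rt N w a (m - 1) u +
        gfun η N w a m u * Trect r s η Nb rt N w (a - 1) m u *
          Trect r s η Nb rt N w (a + 1) m u := by
  obtain ⟨n, rfl⟩ : ∃ n, m = n + 1 := ⟨m - 1, by omega⟩
  have key := rectMatrix_T_system (r := r) (s := s) (η := η) (Nb := Nb) (rt := rt) (N := N)
    (w := w) a n (u - n - 1)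
  have hlow : gfun η N w a (n + 1) u * Trect r s η Nb rt N w (a - 1) (n + 1) u =
      (rectMatrix r s η Nb rt N w ((a : ℤ) - 1) (n + 1) (u - (n + 1 : ℕ) + 1)).det := by
    rcases ha.eq_or_lt with rfl | ha'
    · rw [Trect_zero_left, mul_one, ← det_rectMatrix_zero (r := r) (s := s) (Nb := Nb) (rt := rt)]
      simp
    · rw [gfun, if_neg (by omega), one_mul, Trect_eq_det hJT (by omega), Nat.cast_sub ha,
        Nat.cast_one]
  rw [hlow, Trect_eq_det hJT ha, Trect_eq_det hJT ha, Trect_eq_det hJT ha, Trect_eq_det hJT ha,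
    Trect_eq_det hJT (by omega : 1 ≤ a + 1), Nat.add_sub_cancel]
  have h₁ : u - 1 - (n + 1 : ℕ) + 1 = u - n - 1 := by push_cast; ring
  have h₂ : u + 1 - (n + 1 : ℕ) + 1 = u - n - 1 + 2 := by push_cast; ring
  have h₃ : u - (n + 1 + 1 : ℕ) + 1 = u - n - 1 := by push_cast; ring
  have h₄ : u - n + 1 = u - n - 1 + 2 := by ring
  have h₅ : u - (n + 1 : ℕ) + 1 = u - n - 1 + 1 := by push_cast; ring
  rw [h₁, h₂, h₃, h₄, h₅, Nat.cast_add, Nat.cast_one]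
  exact key

end Tsuboi
end
end

section
/- Assume the quantum Jacobi–Trudi identity T_{λ⊂μ}(u) = det_{1≤i,j≤μ_1}( T^{μ′_i−λ′_j−i+j}(u−μ_1+μ′_1−μ′_i−λ′_j+i+j−1) ) holds for all skew Young diagrams. Then for every integer m ≥ s+2: T_m^{r+1}(u−1)·T_m^{r+1}(u+1) = T_{m+1}^{r+1}(u)·T_{m−1}^{r+1}(u). -/
/-!
Analytic Bethe ansatz for the Lie superalgebra `sl(r+1|s+1)` (Z. Tsuboi,
J. Phys. A: Math. Gen. 30 (1997) 7975-7991).  Common definitions.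
-/

open scoped Classical
open Filter Topology

noncomputable section

namespace Matrix

/-- Jacobi's complementary minor identity, before cancelling `det A`. -/
theorem det_mul_det_adjugate_toBlocks₁₁ {m n R : Type*} [Fintype m] [Fintype n] [DecidableEq m]
    [DecidableEq n] [CommRing R] (A : Matrix (m ⊕ n) (m ⊕ n) R) :
    A.det * A.adjugate.toBlocks₁₁.det = A.det ^ Fintype.card m * A.toBlocks₂₂.det := by
  have hA : fromBlocks A.toBlocks₁₁ A.toBlocks₁₂ A.toBlocks₂₁ A.toBlocks₂₂ *
      fromBlocks A.adjugate.toBlocks₁₁ A.adjugate.toBlocks₁₂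
        A.adjugate.toBlocks₂₁ A.adjugate.toBlocks₂₂ =
      fromBlocks (A.det • 1) 0 0 (A.det • 1) := by
    rw [fromBlocks_toBlocks, fromBlocks_toBlocks, mul_adjugate, ← fromBlocks_one,
      fromBlocks_smul, smul_zero, smul_zero]
  rw [fromBlocks_multiply, fromBlocks_inj] at hA
  obtain ⟨h₁, -, h₂, -⟩ := hA
  have h : A * fromBlocks A.adjugate.toBlocks₁₁ 0 A.adjugate.toBlocks₂₁ 1 =
      fromBlocks (A.det • 1) A.toBlocks₁₂ 0 A.toBlocks₂₂ := by
    conv_lhs => rw [← fromBlocks_toBlocks A]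
    rw [fromBlocks_multiply, fromBlocks_toBlocks, h₁, h₂]
    simp
  have h_det := congrArg det h
  simpa [det_mul, det_fromBlocks_zero₁₂, det_fromBlocks_zero₂₁, det_smul] using h_det

/-- Jacobi's complementary minor identity for the minors of order two of the adjugate. -/
theorem det_adjugate_toBlocks₁₁_fin_two {n R : Type*} [Fintype n] [DecidableEq n] [CommRing R]
    (A : Matrix (Fin 2 ⊕ n) (Fin 2 ⊕ n) R) :
    A.adjugate.toBlocks₁₁.det = A.det * A.toBlocks₂₂.det := by
  let X := mvPolynomialX (Fin 2 ⊕ n) (Fin 2 ⊕ n) ℤ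
  have hX : X.adjugate.toBlocks₁₁.det = X.det * X.toBlocks₂₂.det := by
    apply mul_left_cancel₀ (det_mvPolynomialX_ne_zero (Fin 2 ⊕ n) ℤ)
    rw [det_mul_det_adjugate_toBlocks₁₁ X, Fintype.card_fin, sq, mul_assoc]
  let f := (MvPolynomial.aeval (R := ℤ) fun p : (Fin 2 ⊕ n) × (Fin 2 ⊕ n) => A p.1 p.2).toRingHom
  have hf : f.mapMatrix X = A := mvPolynomialX_mapMatrix_aeval ℤ A
  have h := congrArg f hX
  rw [map_mul, RingHom.map_det, RingHom.map_det, RingHom.map_det] at h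
  rw [← hf, ← RingHom.map_adjugate]
  exact h

/-- The Desnanot–Jacobi identity. -/
theorem det_mul_det_submatrix_desnanot_jacobi {n : ℕ} {R : Type*} [CommRing R]
    (A : Matrix (Fin (n + 2)) (Fin (n + 2)) R) :
    (A.submatrix Fin.castSucc Fin.castSucc).det * (A.submatrix Fin.succ Fin.succ).det =
      A.det * (A.submatrix (fun i : Fin n => i.succ.castSucc) fun j => j.succ.castSucc).det +
        (A.submatrix Fin.succ Fin.castSucc).det * (A.submatrix Fin.castSucc Fin.succ).det := by
  let g : Fin 2 ⊕ Fin n → Fin (n + 2) :=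
    Sum.elim ![0, Fin.last (n + 1)] fun i => i.succ.castSucc
  have hg : Function.Injective g := by
    rintro (i | i) (j | j) h
    · fin_cases i <;> fin_cases j <;> simp_all [g, Fin.ext_iff]
    · have := j.2
      fin_cases i <;> simp [g, Fin.ext_iff] at h
      omega
    · have := i.2
      fin_cases j <;> simp [g, Fin.ext_iff] at h
      omega
    · simpa [g, Fin.ext_iff] using h
  let e : Fin 2 ⊕ Fin n ≃ Fin (n + 2) := Equiv.ofBijective g
    ((Fintype.bijective_iff_injective_and_card g).2 ⟨hg, by simp [add_comm]⟩)
  have h := det_adjugate_toBlocks₁₁_fin_two (A.submatrix e e)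
  rw [adjugate_submatrix_equiv_self, det_submatrix_equiv_self, det_fin_two] at h
  have h₀ : e (Sum.inl 0) = 0 := rfl
  have h₁ : e (Sum.inl 1) = Fin.last (n + 1) := rfl
  have h₂ : (A.submatrix e e).toBlocks₂₂ =
      A.submatrix (fun i : Fin n => i.succ.castSucc) fun j => j.succ.castSucc := rfl
  simp only [toBlocks₁₁, of_apply, submatrix_apply, h₀, h₁, h₂,
    adjugate_fin_succ_eq_det_submatrix, Fin.succAbove_last, Fin.succAbove_zero, Fin.val_zero,
    Fin.val_last] at h
  have hs : ((-1 : R) ^ (n + 1)) * (-1) ^ (n + 1) = 1 := by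
    rw [← mul_pow]
    simp
  simp only [add_zero, zero_add, pow_zero, one_mul, pow_add _ (n + 1) (n + 1), hs] at h
  linear_combination h + (A.submatrix Fin.succ Fin.castSucc).det *
    (A.submatrix Fin.castSucc Fin.succ).det * hs

end Matrix

namespace Tsuboi

theorem rect_mu_one {a : ℕ} (ha : 1 ≤ a) (m : ℕ) : (rect a m).mu 1 = m :=
  if_pos ⟨le_rfl, ha⟩

theorem rect_conjMu {a m j : ℕ} (hjm : j ≤ m) : (rect a m).conjMu j = a := by
  have h : ((Finset.Icc 1 a).filter fun i => j ≤ if 1 ≤ i ∧ i ≤ a then m else 0) =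
      Finset.Icc 1 a := by
    apply Finset.filter_true_of_mem
    intro i hi
    rwa [if_pos (Finset.mem_Icc.1 hi)]
  exact (congrArg Finset.card h).trans (by simp)

theorem rect_conjLam {a m j : ℕ} (hj : 1 ≤ j) : (rect a m).conjLam j = 0 := by
  simp only [Skew.conjLam, rect, Finset.card_eq_zero]
  exact Finset.filter_false_of_mem fun _ _ => by omega

theorem rect_cell {a m i j : ℕ} (hi : i < a) (hj : j < m) :
    (rect a m).cell (i + 1) (j + 1) := by
  refine ⟨by omega, Nat.succ_pos _, ?_⟩
  change j + 1 ≤ if 1 ≤ i + 1 ∧ i + 1 ≤ a then m else 0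
  rw [if_pos (by omega)]
  omega

/-- The quantum Jacobi–Trudi identity for a rectangular diagram. -/
theorem JTcol.rect_eq_det {r s : ℕ} {η : ℂ} {Nb : ℕ → ℕ} {rt : ℕ → ℕ → ℂ} {N : ℕ} {w : ℕ → ℂ}
    (hJT : JTcol r s η Nb rt N w) {a m : ℕ} (ha : 1 ≤ a) (hm : 1 ≤ m) (u : ℂ) :
    Trect r s η Nb rt N w a m u =
      Matrix.det (Matrix.of fun i j : Fin m =>
        TaA r s η Nb rt N w ((a : ℤ) - i.1 + j.1) (u - m + i.1 + j.1 + 1)) := by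
  have hcast : ∀ {k l : ℕ} (_ : k = l) (f : ℕ → ℕ → ℂ),
      Matrix.det (Matrix.of fun i j : Fin k => f i j) =
        Matrix.det (Matrix.of fun i j : Fin l => f i j) := by
    rintro k _ rfl f
    rfl
  rw [Trect, hJT (rect a m) u, hcast (rect_mu_one ha m) fun i j =>
    TaA r s η Nb rt N w
      (((rect a m).conjMu (i + 1) : ℤ) - ((rect a m).conjLam (j + 1) : ℤ) - (i + 1) + (j + 1))
      (u - ((rect a m).mu 1 : ℂ) + ((rect a m).conjMu 1 : ℂ) - ((rect a m).conjMu (i + 1) : ℂ)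
        - ((rect a m).conjLam (j + 1) : ℂ) + ((i : ℂ) + 1) + ((j : ℂ) + 1) - 1)]
  congr 2
  funext i j
  rw [rect_mu_one ha, rect_conjMu hm, rect_conjMu i.2,
    rect_conjLam (Nat.succ_pos _)]
  congr 1
  · push_cast
    ring
  · push_cast
    ring

/-- No tableau is admissible on a rectangle containing the cell `(r+2, s+2)`. -/
theorem not_adm_rect {r s a m : ℕ} (ha : r + 2 ≤ a) (hm : s + 2 ≤ m)
    (t : Fin (rect a m).d × Fin ((rect a m).mu 1) → Fin (r + s + 2)) :
    ¬ Adm r s (rect a m) t := by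
  rintro ⟨-, h⟩
  have hmu : (rect a m).mu 1 = m := rect_mu_one (by omega) m
  have hcol : ∀ i (hi : i ≤ r + 1),
      i ≤ (t (⟨i, show i < a by omega⟩, ⟨0, by omega⟩) : ℕ) := by
    intro i
    induction i with
    | zero => exact fun _ => Nat.zero_le _
    | succ i ih =>
      intro hi
      have h₁ := ih (by omega)
      have h₂ := (h (⟨i, show i < a by omega⟩, ⟨0, by omega⟩)
        (⟨i + 1, show i + 1 < a by omega⟩, ⟨0, by omega⟩)
        (rect_cell (by simp only; omega) (by simp only; omega))
        (rect_cell (by simp only; omega) (by simp only; omega))).2 ⟨rfl, rfl⟩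
      omega
  have hrow : ∀ j (hj : j ≤ s + 1),
      r + 1 + j ≤ (t (⟨r + 1, show r + 1 < a by omega⟩, ⟨j, by omega⟩) : ℕ) := by
    intro j
    induction j with
    | zero => exact fun _ => hcol (r + 1) le_rfl
    | succ j ih =>
      intro hj
      have h₁ := ih (by omega)
      have h₂ := (h (⟨r + 1, show r + 1 < a by omega⟩, ⟨j, by omega⟩)
        (⟨r + 1, show r + 1 < a by omega⟩, ⟨j + 1, by omega⟩)
        (rect_cell (by simp only; omega) (by simp only; omega))
        (rect_cell (by simp only; omega) (by simp only; omega))).1 ⟨rfl, rfl⟩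
      omega
  have h₁ := hrow (s + 1) le_rfl
  have h₂ := (t (⟨r + 1, show r + 1 < a by omega⟩, ⟨s + 1, by omega⟩)).2
  omega

theorem Trect_eq_zero {r s a m : ℕ} (ha : r + 2 ≤ a) (hm : s + 2 ≤ m) (η : ℂ) (Nb : ℕ → ℕ)
    (rt : ℕ → ℕ → ℂ) (N : ℕ) (w : ℕ → ℂ) (u : ℂ) : Trect r s η Nb rt N w a m u = 0 := by
  rw [Trect, Tskew, Finset.filter_false_of_mem fun t _ => not_adm_rect ha hm t,
    Finset.sum_empty, mul_zero]

/-- Assuming the quantum Jacobi–Trudi identity, for every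
`m ≥ s+2`:  `𝒯_m^{r+1}(u−1)𝒯_m^{r+1}(u+1) = 𝒯_{m+1}^{r+1}(u)𝒯_{m−1}^{r+1}(u)`. -/
theorem laplace_row
    (r s : ℕ) (η : ℂ) (hη : Complex.exp (2 * η) ≠ 1)
    (Nb : ℕ → ℕ) (rt : ℕ → ℕ → ℂ) (N : ℕ) (w : ℕ → ℂ)
    (hJT : JTcol r s η Nb rt N w)
    (m : ℕ) (hm : s + 2 ≤ m) (u : ℂ) :
    Trect r s η Nb rt N w (r + 1) m (u - 1) * Trect r s η Nb rt N w (r + 1) m (u + 1) =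
      Trect r s η Nb rt N w (r + 1) (m + 1) u *
        Trect r s η Nb rt N w (r + 1) (m - 1) u := by
  obtain ⟨n, rfl⟩ : ∃ n, m = n + 1 := ⟨m - 1, by omega⟩
  have h_zero := Trect_eq_zero (r := r) (a := r + 2) le_rfl hm η Nb rt N w u
  rw [hJT.rect_eq_det (by omega) (by omega)] at h_zero
  rw [hJT.rect_eq_det (by omega) (by omega), hJT.rect_eq_det (by omega) (by omega),
    hJT.rect_eq_det (by omega) (by omega), hJT.rect_eq_det (by omega) (by omega)]
  have h := Matrix.det_mul_det_submatrix_desnanot_jacobi (n := n)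
    (Matrix.of fun i j : Fin (n + 2) => TaA r s η Nb rt N w (((r + 1 : ℕ) : ℤ) - i.1 + j.1)
      (u - ((n + 1 + 1 : ℕ) : ℂ) + i.1 + j.1 + 1))
  have h_minor : (Matrix.submatrix (Matrix.of fun i j : Fin (n + 2) =>
      TaA r s η Nb rt N w (((r + 1 : ℕ) : ℤ) - i.1 + j.1)
        (u - ((n + 1 + 1 : ℕ) : ℂ) + i.1 + j.1 + 1)) Fin.castSucc Fin.succ).det = 0 := by
    rw [← h_zero]
    congr 1
    ext i j
    simp only [Matrix.submatrix_apply, Matrix.of_apply, Fin.val_castSucc, Fin.val_succ]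
    congr 1 <;> push_cast <;> ring
  rw [h_minor, mul_zero, add_zero] at h
  rw [Nat.add_sub_cancel]
  convert h using 3
  all_goals
    ext i j
    simp only [Matrix.submatrix_apply, Matrix.of_apply, Fin.val_castSucc, Fin.val_succ]
    congr 1 <;> push_cast <;> ring

end Tsuboi
end
end

section
/- (Quantum Jacobi–Trudi formula, column form.) For every skew Young diagram λ ⊂ μ: T_{λ⊂μ}(u) = det_{1≤i,j≤μ_1}( T^{μ′_i−λ′_j−i+j}(u−μ_1+μ′_1−μ′_i−λ′_j+i+j−1) ), where T^a(u) := T_{(1^a)}(u) for a ≥ 1, T^0(u) := P_1(u−1), and T^a(u) := 0 for a < 0. -/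
/-!
Analytic Bethe ansatz for the Lie superalgebra `sl(r+1|s+1)` (Z. Tsuboi,
J. Phys. A: Math. Gen. 30 (1997) 7975-7991).  Common definitions.
-/

open scoped Classical
open Filter Topology

noncomputable section

namespace Tsuboi

/-- The product of the weights `x m` over the half-open interval `g < m ≤ a`. -/
def stripWt (x : ℤ → ℂ) (g a : ℤ) : ℂ := ∏ m ∈ Finset.Ioc g a, x m

lemma stripWt_self (x : ℤ → ℂ) (a : ℤ) : stripWt x a a = 1 := by simp [stripWt]

lemma stripWt_mul (x : ℤ → ℂ) {g m a : ℤ} (hg : g ≤ m) (hm : m ≤ a) :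
    stripWt x g m * stripWt x m a = stripWt x g a := by
  unfold stripWt
  rw [← Finset.prod_union (Finset.disjoint_left.2 fun y hy hy' => by
    simp only [Finset.mem_Ioc] at hy hy'; omega)]
  congr 1
  ext y
  simp only [Finset.mem_union, Finset.mem_Ioc]
  omega

/-- Generating function of the one-column tableaux occupying the diagonals `b < m ≤ a`, with
colours `0, …, n - 1` of weight `x c m`; colours up to `r` do not repeat. -/
def colGen (r : ℕ) (x : ℕ → ℤ → ℂ) : ℕ → ℤ → ℤ → ℂ
  | 0, b, a => if a = b then 1 else 0
  | n + 1, b, a =>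
    ∑ g ∈ Finset.Icc (if n ≤ r then a - 1 else b) a, stripWt (x n) g a * colGen r x n b g

section colGen

variable {r : ℕ} {x : ℕ → ℤ → ℂ}

lemma colGen_of_lt (n : ℕ) {b a : ℤ} (h : a < b) : colGen r x n b a = 0 := by
  induction n generalizing a with
  | zero => simp [colGen, h.ne]
  | succ n ih =>
    refine Finset.sum_eq_zero fun g hg => ?_
    rw [ih (by simp only [Finset.mem_Icc] at hg; omega), mul_zero]

lemma colGen_self (n : ℕ) (b : ℤ) : colGen r x n b b = 1 := by
  induction n with
  | zero => simp [colGen]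
  | succ n ih =>
    rw [colGen, Finset.sum_eq_single b, ih, stripWt_self, mul_one]
    · intro g hg hne
      rw [colGen_of_lt n (by simp only [Finset.mem_Icc] at hg; omega), mul_zero]
    · intro h
      exact absurd (Finset.mem_Icc.2 ⟨by split_ifs <;> omega, le_rfl⟩) h

lemma colGen_succ_of_lower {n : ℕ} (hn : r < n) {b lo a : ℤ} (hlo : lo ≤ b) :
    colGen r x (n + 1) b a =
      ∑ g ∈ Finset.Icc lo a, stripWt (x n) g a * colGen r x n b g := by
  rw [colGen, if_neg hn.not_ge]
  refine Finset.sum_subset (Finset.Icc_subset_Icc_left hlo) fun g hg hg' => ?_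
  rw [colGen_of_lt n (by simp only [Finset.mem_Icc] at hg hg'; omega), mul_zero]

lemma colGen_succ_split {n : ℕ} (hn : r < n) {b lo a : ℤ} (hlo : lo ≤ a) :
    colGen r x (n + 1) b a =
      ∑ g ∈ Finset.Icc (lo + 1) a, stripWt (x n) g a * colGen r x n b g +
        stripWt (x n) lo a * colGen r x (n + 1) b lo := by
  rcases lt_or_ge lo b with hb | hb
  · rw [colGen_of_lt (n + 1) hb, mul_zero, add_zero,
      colGen_succ_of_lower (lo := lo + 1) hn (by omega)]
  · have hsplit : Finset.Icc b a = Finset.Icc (lo + 1) a ∪ Finset.Icc b lo := by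
      ext y
      simp only [Finset.mem_union, Finset.mem_Icc]
      omega
    rw [colGen_succ_of_lower hn le_rfl, hsplit, Finset.sum_union
      (Finset.disjoint_left.2 fun y hy hy' => by
        simp only [Finset.mem_Icc] at hy hy'; omega),
      colGen_succ_of_lower hn le_rfl, Finset.mul_sum]
    congr 1
    refine Finset.sum_congr rfl fun g hg => ?_
    rw [← stripWt_mul (x n) (Finset.mem_Icc.1 hg).2 hlo]
    ring

lemma colGen_shift (n : ℕ) (c b a : ℤ) :
    colGen r (fun i m => x i (m + c)) n b a = colGen r x n (b + c) (a + c) := by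
  induction n generalizing a with
  | zero => simp [colGen]
  | succ n ih =>
    unfold colGen
    refine Finset.sum_bij (fun g _ => g + c) ?_ ?_ ?_ ?_
    · intro g hg
      simp only [Finset.mem_Icc] at hg ⊢
      split_ifs at hg ⊢ <;> omega
    · intro g _ g' _ h
      simpa using h
    · intro g hg
      refine ⟨g - c, ?_, by ring⟩
      simp only [Finset.mem_Icc] at hg ⊢
      split_ifs at hg ⊢ <;> omega
    · intro g _
      rw [ih]
      congr 1
      refine Finset.prod_bij (fun m _ => m + c) ?_ ?_ ?_ ?_
      · intro m hm
        simp only [Finset.mem_Ioc] at hm ⊢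
        omega
      · intro m _ m' _ h
        simpa using h
      · intro m hm
        refine ⟨m - c, ?_, by ring⟩
        simp only [Finset.mem_Ioc] at hm ⊢
        omega
      · intro m _
        rfl

/-- A column has vacuum factor `G m` on every diagonal below its top cell. -/
lemma colGen_eq_zero_of_vacuum {G : ℤ → ℂ} (hx : ∀ n m, n ≠ 0 → G m = 0 → x n m = 0)
    (n : ℕ) {b a m : ℤ} (hm : m ∈ Finset.Ioc (b + 1) a) (hG : G m = 0) :
    colGen r x n b a = 0 := by
  induction n generalizing a with
  | zero =>
    rw [Finset.mem_Ioc] at hm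
    rw [colGen, if_neg (by omega)]
  | succ n ih =>
    refine Finset.sum_eq_zero fun g hg => ?_
    rw [Finset.mem_Ioc] at hm
    rw [Finset.mem_Icc] at hg
    rcases le_or_gt m g with h | h
    · rw [ih (Finset.mem_Ioc.2 ⟨hm.1, h⟩), mul_zero]
    · rcases eq_or_ne n 0 with rfl | hn
      · rw [if_pos (Nat.zero_le r)] at hg
        rw [colGen, if_neg (by omega), mul_zero]
      · rw [stripWt, Finset.prod_eq_zero (Finset.mem_Ioc.2 ⟨h, hm.2⟩) (hx n m hn hG), zero_mul]

end colGen

lemma antitone_of_adjacent {k : ℕ} {f : Fin k → ℤ}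
    (h : ∀ i j : Fin k, j.1 = i.1 + 1 → f j ≤ f i) : Antitone f := by
  cases k with
  | zero => exact fun i => i.elim0
  | succ k => exact Fin.antitone_iff_succ_le.2 fun i => h _ _ (by simp)

/-- A square matrix with a zero block meeting the diagonal has zero determinant. -/
lemma det_eq_zero_of_zero_block {k : ℕ} (M : Matrix (Fin k) (Fin k) ℂ) (p : Fin k)
    (h : ∀ i j, p ≤ i → j ≤ p → M i j = 0) : M.det = 0 := by
  rw [Matrix.det_apply]
  refine Finset.sum_eq_zero fun σ _ => ?_
  obtain ⟨i, hi, hσ⟩ : ∃ i, i ≤ p ∧ p ≤ σ i := by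
    by_contra! hcon
    have := Finset.card_le_card_of_injOn (s := Finset.Iic p) (t := Finset.Iio p) σ
      (fun i hi => by simpa using hcon i (by simpa using hi)) σ.injective.injOn
    simp at this
  exact smul_eq_zero_of_right _ (Finset.prod_eq_zero (Finset.mem_univ i) (h _ _ hσ hi))

/-- The Jacobi–Trudi determinant for columns occupying the rows `l j < i ≤ h j`. -/
def colDet (r : ℕ) (x : ℕ → ℤ → ℂ) (n : ℕ) {k : ℕ} (l h : Fin k → ℤ) : ℂ :=
  Matrix.det (Matrix.of fun i j : Fin k =>
    colGen r x n (l j - (j.1 : ℤ)) (h i - (i.1 : ℤ)))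

/-- The height of the next column, or `0` after the last one. -/
def nextHeight {k : ℕ} (h : Fin k → ℤ) (j : Fin k) : ℤ :=
  if hj : j.1 + 1 < k then h ⟨j.1 + 1, hj⟩ else 0

/-- The possible column heights after removing the cells of colour `n`. -/
def stripRange (r n : ℕ) {k : ℕ} (h : Fin k → ℤ) (j : Fin k) : Finset ℤ :=
  Finset.Icc (if n ≤ r then h j - 1 else nextHeight h j) (h j)

section colDet

variable {r : ℕ} {x : ℕ → ℤ → ℂ} {k : ℕ} {l h : Fin k → ℤ}

lemma sub_lt_sub_of_antitone (hh : Antitone h) {i j : Fin k} (hij : i ≤ j) :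
    h j - (j.1 : ℤ) ≤ h i - (i.1 : ℤ) := by
  have := hh hij
  have : i.1 ≤ j.1 := hij
  omega

lemma colDet_eq_zero_of_lt (n : ℕ) (hl : Antitone l) (hh : Antitone h) {p : Fin k}
    (hp : h p < l p) : colDet r x n l h = 0 := by
  refine det_eq_zero_of_zero_block _ p fun i j hi hj => colGen_of_lt n ?_
  have := sub_lt_sub_of_antitone hh hi
  have := sub_lt_sub_of_antitone hl hj
  omega

lemma colDet_eq_zero_of_step (n : ℕ) {i j : Fin k} (hij : j.1 = i.1 + 1)
    (h1 : h j = h i + 1) : colDet r x n l h = 0 := by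
  refine Matrix.det_zero_of_row_eq (i := i) (j := j) (by
    intro he; rw [he] at hij; omega) ?_
  ext q
  simp only [Matrix.of_apply]
  congr 1
  omega

lemma colDet_zero_self (hl : Antitone l) : colDet r x 0 l l = 1 := by
  rw [colDet, show (Matrix.of fun i j : Fin k =>
    colGen r x 0 (l j - (j.1 : ℤ)) (l i - (i.1 : ℤ))) = 1 from ?_, Matrix.det_one]
  ext i j
  rw [Matrix.of_apply, colGen, Matrix.one_apply]
  congr 1
  refine propext ⟨fun he => ?_, fun he => by rw [he]⟩
  rcases le_total i j with hij | hij
  · have := hl hij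
    have : i.1 ≤ j.1 := hij
    exact Fin.ext (by omega)
  · have := hl hij
    have : j.1 ≤ i.1 := hij
    exact Fin.ext (by omega)

lemma colDet_zero_of_lt (hl : Antitone l) (hh : Antitone h) {p : Fin k} (hp : l p < h p) :
    colDet r x 0 l h = 0 := by
  rw [colDet, ← Matrix.det_transpose]
  refine det_eq_zero_of_zero_block _ p fun i j hi hj => ?_
  have := sub_lt_sub_of_antitone hh hj
  have := sub_lt_sub_of_antitone hl hi
  rw [Matrix.transpose_apply, Matrix.of_apply, colGen, if_neg (by omega)]

lemma det_sum_smul_rows {A : Fin k → Finset ℤ} (c : Fin k → ℤ → ℂ)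
    (v : Fin k → ℤ → Fin k → ℂ) :
    Matrix.det (Matrix.of fun i j => ∑ g ∈ A i, c i g * v i g j) =
      ∑ γ ∈ Fintype.piFinset A, (∏ i, c i (γ i)) *
        Matrix.det (Matrix.of fun i j => v i (γ i) j) := by
  have h1 : (Matrix.of fun i j => ∑ g ∈ A i, c i g * v i g j) =
      fun i => ∑ g ∈ A i, c i g • v i g := by
    ext i j
    simp [Finset.sum_apply]
  have h2 := (Matrix.detRowAlternating (R := ℂ) (n := Fin k)).toMultilinearMap.map_sum_finset
    (fun i g => c i g • v i g) A
  rw [h1]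
  refine h2.trans (Finset.sum_congr rfl fun γ _ => ?_)
  exact (Matrix.detRowAlternating (R := ℂ) (n := Fin k)).toMultilinearMap.map_smul_univ
    (fun i => c i (γ i)) (fun i => v i (γ i))

lemma det_sub_smul_next (M : Matrix (Fin k) (Fin k) ℂ) (c : Fin k → ℂ) :
    M.det = Matrix.det (Matrix.of fun i j =>
      M i j - if hi : i.1 + 1 < k then c i * M ⟨i.1 + 1, hi⟩ j else 0) := by
  have hU : Matrix.det (Matrix.of fun i j : Fin k =>
      (if i = j then (1 : ℂ) else 0) - if j.1 = i.1 + 1 then c i else 0) = 1 := by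
    rw [Matrix.det_of_isUpperTriangular]
    · exact Finset.prod_eq_one fun i _ => by simp
    · intro i j hij
      have : j.1 < i.1 := hij
      rw [Matrix.of_apply, if_neg (by rintro rfl; omega), if_neg (by omega), sub_zero]
  rw [← one_mul M.det, ← hU, ← Matrix.det_mul]
  congr 1
  ext i j
  simp only [Matrix.mul_apply, Matrix.of_apply, sub_mul, Finset.sum_sub_distrib, ite_mul,
    one_mul, zero_mul, Finset.sum_ite_eq, Finset.mem_univ, if_true]
  congr 1
  split_ifs with hi
  · rw [Finset.sum_eq_single ⟨i.1 + 1, hi⟩]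
    · simp
    · intro q _ hq
      exact if_neg fun he => hq (Fin.ext he)
    · simp
  · exact Finset.sum_eq_zero fun q _ => if_neg (by omega)

/-- Removing the cells of the largest colour from a Jacobi–Trudi determinant. -/
lemma colDet_succ (n : ℕ) (hl0 : ∀ j, 0 ≤ l j) (hh : Antitone h) :
    colDet r x (n + 1) l h = ∑ γ ∈ Fintype.piFinset (stripRange r n h),
      (∏ j, stripWt (x n) (γ j - (j.1 : ℤ)) (h j - (j.1 : ℤ))) * colDet r x n l γ := by
  have hshift : ∀ (lo : ℤ) (i j : Fin k),
      ∑ g ∈ Finset.Icc (lo - (i.1 : ℤ)) (h i - (i.1 : ℤ)),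
        stripWt (x n) g (h i - (i.1 : ℤ)) * colGen r x n (l j - (j.1 : ℤ)) g =
      ∑ g ∈ Finset.Icc lo (h i), stripWt (x n) (g - (i.1 : ℤ)) (h i - (i.1 : ℤ)) *
        colGen r x n (l j - (j.1 : ℤ)) (g - (i.1 : ℤ)) := by
    intro lo i j
    symm
    refine Finset.sum_bij (fun g _ => g - (i.1 : ℤ)) ?_ ?_ ?_ fun _ _ => rfl
    · intro g hg
      simp only [Finset.mem_Icc] at hg ⊢
      omega
    · intro g _ g' _ he
      simpa using he
    · intro g hg
      refine ⟨g + i.1, ?_, by ring⟩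
      simp only [Finset.mem_Icc] at hg ⊢
      omega
  have key : colDet r x (n + 1) l h = Matrix.det (Matrix.of fun i j : Fin k =>
      ∑ g ∈ stripRange r n h i, stripWt (x n) (g - (i.1 : ℤ)) (h i - (i.1 : ℤ)) *
        colGen r x n (l j - (j.1 : ℤ)) (g - (i.1 : ℤ))) := by
    by_cases hn : n ≤ r
    · unfold colDet
      congr 1
      ext i j
      simp only [Matrix.of_apply, stripRange, if_pos hn]
      rw [← hshift, colGen, if_pos hn]
      congr 2
      ring
    · rw [colDet, det_sub_smul_next _ fun i =>
        stripWt (x n) (nextHeight h i - (i.1 : ℤ) - 1) (h i - (i.1 : ℤ))]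
      congr 1
      ext i j
      simp only [Matrix.of_apply, stripRange, if_neg hn]
      rw [← hshift]
      by_cases hi : i.1 + 1 < k
      · have hle : h ⟨i.1 + 1, hi⟩ ≤ h i := hh (Fin.mk_le_mk.2 (Nat.le_succ _))
        rw [dif_pos hi, colGen_succ_split (lo := nextHeight h i - (i.1 : ℤ) - 1) (by omega)
          (by rw [nextHeight, dif_pos hi]; omega), sub_add_cancel]
        rw [sub_eq_iff_eq_add]
        congr 3
        rw [nextHeight, dif_pos hi]
        push_cast
        ring
      · rw [dif_neg hi, sub_zero, nextHeight, dif_neg hi]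
        refine colGen_succ_of_lower (by omega) ?_
        have := hl0 j
        omega
  rw [key]
  exact det_sum_smul_rows
    (fun i g => stripWt (x n) (g - (i.1 : ℤ)) (h i - (i.1 : ℤ)))
    (fun i g j => colGen r x n (l j - (j.1 : ℤ)) (g - (i.1 : ℤ)))

end colDet

/-- The cell `p` lies in the skew diagram with columns `l j ≤ i < h j`. -/
def InCols {d k : ℕ} (l h : Fin k → ℤ) (p : Fin d × Fin k) : Prop :=
  l p.2 ≤ (p.1.1 : ℤ) ∧ (p.1.1 : ℤ) < h p.2

/-- The row and column conditions on a pair of cells of an admissible tableau. -/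
def AdmPair (r : ℕ) {d k : ℕ} (t : Fin d × Fin k → ℕ) (p q : Fin d × Fin k) : Prop :=
  (q.1.1 = p.1.1 ∧ q.2.1 = p.2.1 + 1 → t p ≤ t q ∧ (r + 2 ≤ t p + 1 → t p < t q)) ∧
  (q.1.1 = p.1.1 + 1 ∧ q.2.1 = p.2.1 → t p ≤ t q ∧ (t p + 1 ≤ r + 1 → t p < t q))

/-- The admissible tableaux with colours `0, …, n - 1` on a skew diagram given by columns. -/
def colTab (r d n : ℕ) {k : ℕ} (l h : Fin k → ℤ) : Finset (Fin d × Fin k → ℕ) :=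
  (Fintype.piFinset fun p => if InCols l h p then Finset.range n else {0}).filter fun t =>
    ∀ p q, InCols l h p → InCols l h q → AdmPair r t p q

/-- The weight of a tableau. -/
def tabWt (x : ℕ → ℤ → ℂ) {d k : ℕ} (l h : Fin k → ℤ) (t : Fin d × Fin k → ℕ) : ℂ :=
  ∏ p : Fin d × Fin k,
    if InCols l h p then x (t p) ((p.1.1 : ℤ) + 1 - (p.2.1 : ℤ)) else 1

section tableaux

variable {r d n k : ℕ} {x : ℕ → ℤ → ℂ} {l h γ : Fin k → ℤ} {t s : Fin d × Fin k → ℕ}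

lemma mem_colTab : t ∈ colTab r d n l h ↔
    (∀ p, InCols l h p → t p < n) ∧ (∀ p, ¬ InCols l h p → t p = 0) ∧
      ∀ p q, InCols l h p → InCols l h q → AdmPair r t p q := by
  have hcells : (∀ p, t p ∈ if InCols l h p then Finset.range n else {0}) ↔
      (∀ p, InCols l h p → t p < n) ∧ ∀ p, ¬ InCols l h p → t p = 0 := by
    rw [← forall_and]
    refine forall_congr' fun p => ?_
    by_cases hp : InCols l h p <;> simp [hp]
  rw [colTab, Finset.mem_filter, Fintype.mem_piFinset, hcells, and_assoc]

lemma exists_threshold (P : ℤ → Prop) {a b : ℤ} (hab : a ≤ b)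
    (hP : ∀ i, a ≤ i → i + 1 < b → P (i + 1) → P i) :
    ∃ g, a ≤ g ∧ g ≤ b ∧ ∀ i, a ≤ i → i < b → (P i ↔ i < g) := by
  induction b, hab using Int.leInduction with
  | base => exact ⟨a, le_rfl, le_rfl, fun i _ _ => by omega⟩
  | succ b hab ih =>
    obtain ⟨g, hg, hgb, hi⟩ := ih fun i hi hib => hP i hi (by omega)
    rcases hgb.eq_or_lt with rfl | hlt
    · by_cases hPg : P g
      · refine ⟨g + 1, by omega, le_rfl, fun i h1 h2 => ?_⟩
        rcases eq_or_ne i g with rfl | hne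
        · exact iff_of_true hPg h2
        · have := hi i h1 (by omega)
          rw [this]
          omega
      · refine ⟨g, hg, by omega, fun i h1 h2 => ?_⟩
        rcases eq_or_ne i g with rfl | hne
        · exact iff_of_false hPg (lt_irrefl _)
        · exact hi i h1 (by omega)
    · refine ⟨g, hg, by omega, fun i h1 h2 => ?_⟩
      rcases eq_or_ne i b with rfl | hne
      · refine iff_of_false (fun hPi => ?_) (by omega)
        have hpred := hP (i - 1) (by omega) (by omega) (by rwa [sub_add_cancel])
        have := (hi (i - 1) (by omega) (by omega)).1 hpred
        omega
      · exact hi i h1 (by omega)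

/-- Add the largest colour `n` to a tableau, on the cells `γ j ≤ i < h j`. -/
def extendTab (n : ℕ) (γ h : Fin k → ℤ) (s : Fin d × Fin k → ℕ) (p : Fin d × Fin k) : ℕ :=
  if InCols γ h p then n else s p

lemma prod_stripWt (y : ℤ → ℂ) (h0 : ∀ j, 0 ≤ γ j) (hd : ∀ j, h j ≤ d) :
    ∏ p : Fin d × Fin k, (if InCols γ h p then y ((p.1.1 : ℤ) + 1 - (p.2.1 : ℤ)) else 1) =
      ∏ j, stripWt y (γ j - (j.1 : ℤ)) (h j - (j.1 : ℤ)) := by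
  rw [Fintype.prod_prod_type_right]
  refine Finset.prod_congr rfl fun j _ => ?_
  rw [← Finset.prod_filter, stripWt]
  refine Finset.prod_bij (fun i _ => (i.1 : ℤ) + 1 - (j.1 : ℤ)) ?_ ?_ ?_ fun _ _ => rfl
  · intro i hi
    have hc := (Finset.mem_filter.1 hi).2
    unfold InCols at hc
    dsimp only at hc
    rw [Finset.mem_Ioc]
    omega
  · intro i _ i' _ he
    exact Fin.ext (by omega)
  · intro m hm
    rw [Finset.mem_Ioc] at hm
    have := h0 j
    have := hd j
    refine ⟨⟨(m - 1 + j.1).toNat, by omega⟩, ?_, ?_⟩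
    · refine Finset.mem_filter.2 ⟨Finset.mem_univ _, ?_⟩
      unfold InCols
      dsimp only
      omega
    · dsimp only
      omega

lemma tabWt_extendTab (hlγ : l ≤ γ) (hγh : γ ≤ h) (hl0 : ∀ j, 0 ≤ l j) (hd : ∀ j, h j ≤ d) :
    tabWt x l h (extendTab n γ h s) =
      (∏ j, stripWt (x n) (γ j - (j.1 : ℤ)) (h j - (j.1 : ℤ))) * tabWt x l γ s := by
  rw [← prod_stripWt (x n) (fun j => (hl0 j).trans (hlγ j)) hd, tabWt, tabWt,
    ← Finset.prod_mul_distrib]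
  refine Finset.prod_congr rfl fun p _ => ?_
  have h1 : l p.2 ≤ γ p.2 := hlγ p.2
  have h2 : γ p.2 ≤ h p.2 := hγh p.2
  unfold extendTab InCols
  by_cases hp : γ p.2 ≤ (p.1.1 : ℤ)
  · by_cases hp' : (p.1.1 : ℤ) < h p.2
    · rw [if_pos ⟨by omega, hp'⟩, if_pos ⟨hp, hp'⟩, if_pos ⟨hp, hp'⟩, if_neg (by omega), mul_one]
    · rw [if_neg (by omega), if_neg (by omega), if_neg (by omega), mul_one]
  · by_cases hp' : l p.2 ≤ (p.1.1 : ℤ)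
    · rw [if_pos (by omega), if_neg (by omega), if_neg (by omega), if_pos (by omega), one_mul]
    · rw [if_neg (by omega), if_neg (by omega), if_neg (by omega), mul_one]

lemma nextHeight_of_adjacent {i j : Fin k} (hij : j.1 = i.1 + 1) : nextHeight h i = h j := by
  have hi : i.1 + 1 < k := hij ▸ j.2
  rw [nextHeight, dif_pos hi]
  exact congrArg h (Fin.ext hij.symm)

lemma extendTab_mem (hlγ : l ≤ γ) (hγ : Antitone γ)
    (hmem : γ ∈ Fintype.piFinset (stripRange r n h)) (hs : s ∈ colTab r d n l γ) :
    extendTab n γ h s ∈ colTab r d (n + 1) l h := by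
  rw [mem_colTab] at hs ⊢
  obtain ⟨hs1, hs2, hs3⟩ := hs
  have hb : ∀ j, (if n ≤ r then h j - 1 else nextHeight h j) ≤ γ j ∧ γ j ≤ h j := fun j => by
    have := Fintype.mem_piFinset.1 hmem j
    rwa [stripRange, Finset.mem_Icc] at this
  have hcell : ∀ p : Fin d × Fin k, InCols l h p → (InCols γ h p ∧ extendTab n γ h s p = n) ∨
      ((p.1.1 : ℤ) < γ p.2 ∧ InCols l γ p ∧ extendTab n γ h s p = s p ∧ s p < n) := by
    intro p hp
    rcases le_or_gt (γ p.2) (p.1.1 : ℤ) with hle | hlt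
    · exact Or.inl ⟨⟨hle, hp.2⟩, if_pos ⟨hle, hp.2⟩⟩
    · exact Or.inr ⟨hlt, ⟨hp.1, hlt⟩, if_neg fun hc => hc.1.not_gt hlt, hs1 p ⟨hp.1, hlt⟩⟩
  refine ⟨fun p hp => ?_, fun p hp => ?_, fun p q hp hq => ?_⟩
  · rcases hcell p hp with ⟨_, h2⟩ | ⟨_, _, h2, _⟩ <;> omega
  · have h1 : ¬ InCols γ h p := fun hc => hp ⟨(hlγ p.2).trans hc.1, hc.2⟩
    rw [extendTab, if_neg h1]
    exact hs2 p fun hc => hp ⟨hc.1, hc.2.trans_le (hb p.2).2⟩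
  · rcases hcell p hp with ⟨hp1, hp2⟩ | ⟨hp0, hp1, hp2, hp3⟩ <;>
      rcases hcell q hq with ⟨hq1, hq2⟩ | ⟨hq0, hq1, hq2, hq3⟩ <;>
      unfold AdmPair <;> rw [hp2, hq2]
    · constructor
      · rintro ⟨h1, h2⟩
        refine ⟨le_rfl, fun hn => ?_⟩
        have := (hb p.2).1
        rw [if_neg (by omega), nextHeight_of_adjacent h2] at this
        have := hp1.1
        have := hq1.2
        have := (hb p.2).2
        unfold InCols at hp1 hq1
        omega
      · rintro ⟨h1, h2⟩
        refine ⟨le_rfl, fun hn => ?_⟩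
        have := (hb p.2).1
        rw [if_pos (by omega)] at this
        have h3 : q.2 = p.2 := Fin.ext h2
        have h4 := hq1.2
        rw [h3] at h4
        have := hp1.1
        omega
    · constructor
      · rintro ⟨h1, h2⟩
        have h3 : γ q.2 ≤ γ p.2 := hγ (show p.2.1 ≤ q.2.1 by omega)
        have := hp1.1
        omega
      · rintro ⟨h1, h2⟩
        have h3 : q.2 = p.2 := Fin.ext h2
        rw [h3] at hq0
        have := hp1.1
        omega
    · exact ⟨fun _ => ⟨hp3.le, fun _ => hp3⟩, fun _ => ⟨hp3.le, fun _ => hp3⟩⟩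
    · exact hs3 p q hp1 hq1

lemma extendTab_injective {γ' : Fin k → ℤ} {s' : Fin d × Fin k → ℕ}
    (hl0 : ∀ j, 0 ≤ l j) (hd : ∀ j, h j ≤ d) (hlγ : l ≤ γ) (hγh' : γ' ≤ h)
    (hs' : s' ∈ colTab r d n l γ')
    (he : extendTab n γ h s = extendTab n γ' h s') : γ' ≤ γ := by
  intro j
  by_contra hnot
  have hlt : γ j < γ' j := not_le.1 hnot
  have h1 : l j ≤ γ j := hlγ j
  have h2 : γ' j ≤ h j := hγh' j
  have h3 := hl0 j
  have h4 := hd j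
  have h5 := congrFun he (⟨(γ j).toNat, by omega⟩, j)
  have h6 : ((γ j).toNat : ℤ) = γ j := Int.toNat_of_nonneg (by omega)
  unfold extendTab at h5
  rw [if_pos (by unfold InCols; dsimp only; omega),
    if_neg (by unfold InCols; dsimp only; omega)] at h5
  have h7 := (mem_colTab.1 hs').1 (⟨(γ j).toNat, by omega⟩, j)
    (by unfold InCols; dsimp only; omega)
  omega

lemma exists_extendTab (hl : Antitone l) (hl0 : ∀ j, 0 ≤ l j) (hlh : l ≤ h) (hh : Antitone h)
    (hd : ∀ j, h j ≤ d) (ht : t ∈ colTab r d (n + 1) l h) :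
    ∃ γ ∈ Fintype.piFinset (stripRange r n h), Antitone γ ∧ l ≤ γ ∧
      ∃ s ∈ colTab r d n l γ, extendTab n γ h s = t := by
  obtain ⟨ht1, ht2, ht3⟩ := mem_colTab.1 ht
  have hrow : ∀ (i : Fin d) (j j' : Fin k), InCols l h (i, j) → InCols l h (i, j') →
      j'.1 = j.1 + 1 → t (i, j) ≤ t (i, j') ∧ (r + 2 ≤ t (i, j) + 1 → t (i, j) < t (i, j')) :=
    fun i j j' hp hq hj => (ht3 _ _ hp hq).1 ⟨rfl, hj⟩
  have hcol : ∀ (i i' : Fin d) (j : Fin k), InCols l h (i, j) → InCols l h (i', j) →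
      i'.1 = i.1 + 1 → t (i, j) ≤ t (i', j) ∧ (t (i, j) + 1 ≤ r + 1 → t (i, j) < t (i', j)) :=
    fun i i' j hp hq hj => (ht3 _ _ hp hq).2 ⟨hj, rfl⟩
  have hex : ∀ j : Fin k, ∃ g, l j ≤ g ∧ g ≤ h j ∧
      ∀ i : Fin d, InCols l h (i, j) → (t (i, j) < n ↔ (i.1 : ℤ) < g) := by
    intro j
    obtain ⟨g, h1, h2, h3⟩ := exists_threshold
      (fun i => ∀ i' : Fin d, (i'.1 : ℤ) = i → t (i', j) < n) (hlh j) (by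
        intro i hi hi' hP i₀ hi₀
        have h4 := hd j
        have h5 := hP ⟨i₀.1 + 1, by omega⟩ (by push_cast; omega)
        have h6 := hcol i₀ ⟨i₀.1 + 1, by omega⟩ j (by unfold InCols; dsimp only; omega)
          (by unfold InCols; dsimp only; push_cast; omega) rfl
        omega)
    refine ⟨g, h1, h2, fun i hi => ?_⟩
    rw [← h3 i.1 hi.1 hi.2]
    refine ⟨fun hlt i' hi' => ?_, fun hP => hP i rfl⟩
    rwa [show i' = i from Fin.ext (by exact_mod_cast hi')]
  choose γ hlγ hγh hγ using hex
  have hge : ∀ (i : Fin d) (j : Fin k), InCols γ h (i, j) → t (i, j) = n := by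
    intro i j hp
    have hc : InCols l h (i, j) := ⟨(hlγ j).trans hp.1, hp.2⟩
    have h1 := ht1 _ hc
    have h2 : ¬ t (i, j) < n := fun hlt => hp.1.not_gt ((hγ j i hc).1 hlt)
    omega
  have hanti : Antitone γ := antitone_of_adjacent fun j j' hj => by
    by_contra! hlt
    have hl' : l j' ≤ l j := hl (show j.1 ≤ j'.1 by omega)
    have hh' : h j' ≤ h j := hh (show j.1 ≤ j'.1 by omega)
    have h1 := hlγ j
    have h2 := hγh j'
    have h3 := hl0 j
    have h4 := hd j'
    have h6 : ((γ j).toNat : ℤ) = γ j := Int.toNat_of_nonneg (by omega)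
    have hc : InCols l h ((⟨(γ j).toNat, by omega⟩ : Fin d), j) := by
      unfold InCols; dsimp only; omega
    have hc' : InCols l h ((⟨(γ j).toNat, by omega⟩ : Fin d), j') := by
      unfold InCols; dsimp only; omega
    have h7 := hrow _ _ _ hc hc' hj
    have h8 := (hγ j' _ hc').2 (by dsimp only; omega)
    have h9 := (hγ j _ hc).1 (by omega)
    dsimp only at h9
    omega
  refine ⟨γ, ?_, hanti, hlγ, fun p => if InCols l γ p then t p else 0, ?_, ?_⟩
  · refine Fintype.mem_piFinset.2 fun j => Finset.mem_Icc.2 ⟨?_, hγh j⟩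
    have h1 := hlγ j
    have h3 := hl0 j
    have h4 := hd j
    have h6 : ((γ j).toNat : ℤ) = γ j := Int.toNat_of_nonneg (by omega)
    split_ifs with hn
    · by_contra! hlt
      have e1 := hge ⟨(γ j).toNat, by omega⟩ j (by unfold InCols; dsimp only; omega)
      have e2 := hge ⟨(γ j).toNat + 1, by omega⟩ j
        (by unfold InCols; dsimp only; push_cast; omega)
      have e3 := hcol ⟨(γ j).toNat, by omega⟩ ⟨(γ j).toNat + 1, by omega⟩ j
        (by unfold InCols; dsimp only; omega)
        (by unfold InCols; dsimp only; push_cast; omega) rfl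
      omega
    · unfold nextHeight
      split_ifs with hj
      · by_contra! hlt
        have hh' : h ⟨j.1 + 1, hj⟩ ≤ h j := hh (Fin.mk_le_mk.2 (Nat.le_succ _))
        have hγ' : γ ⟨j.1 + 1, hj⟩ ≤ γ j := hanti (Fin.mk_le_mk.2 (Nat.le_succ _))
        have hl' := hlγ ⟨j.1 + 1, hj⟩
        have e1 := hge ⟨(γ j).toNat, by omega⟩ j (by unfold InCols; dsimp only; omega)
        have e2 := hge ⟨(γ j).toNat, by omega⟩ ⟨j.1 + 1, hj⟩
          (by unfold InCols; dsimp only; omega)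
        have e3 := hrow ⟨(γ j).toNat, by omega⟩ j ⟨j.1 + 1, hj⟩
          (by unfold InCols; dsimp only; omega)
          (by unfold InCols; dsimp only; omega) rfl
        omega
      · omega
  · refine mem_colTab.2 ⟨fun p hp => ?_, fun p hp => if_neg hp, fun p q hp hq => ?_⟩
    · rw [if_pos hp]
      exact (hγ p.2 p.1 ⟨hp.1, hp.2.trans_le (hγh p.2)⟩).2 hp.2
    · unfold AdmPair
      dsimp only
      rw [if_pos hp, if_pos hq]
      exact ht3 p q ⟨hp.1, hp.2.trans_le (hγh p.2)⟩ ⟨hq.1, hq.2.trans_le (hγh q.2)⟩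
  · ext p
    unfold extendTab
    dsimp only
    split_ifs with h1 h2
    · exact (hge p.1 p.2 h1).symm
    · rfl
    · refine (ht2 p fun hc => ?_).symm
      rcases le_or_gt (γ p.2) (p.1.1 : ℤ) with hle | hlt
      · exact h1 ⟨hle, hc.2⟩
      · exact h2 ⟨hc.1, hlt⟩

/-- Removing the cells of the largest colour from the tableaux. -/
lemma sum_colTab_succ (hl : Antitone l) (hl0 : ∀ j, 0 ≤ l j) (hlh : l ≤ h) (hh : Antitone h)
    (hd : ∀ j, h j ≤ d) :
    ∑ t ∈ colTab r d (n + 1) l h, tabWt x l h t =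
      ∑ γ ∈ (Fintype.piFinset (stripRange r n h)).filter (fun γ => Antitone γ ∧ l ≤ γ),
        (∏ j, stripWt (x n) (γ j - (j.1 : ℤ)) (h j - (j.1 : ℤ))) *
          ∑ s ∈ colTab r d n l γ, tabWt x l γ s := by
  have hle : ∀ {γ : Fin k → ℤ}, γ ∈ Fintype.piFinset (stripRange r n h) → γ ≤ h :=
    fun hγ j => (Finset.mem_Icc.1 (Fintype.mem_piFinset.1 hγ j)).2
  simp_rw [Finset.mul_sum]
  rw [Finset.sum_sigma']
  symm
  refine Finset.sum_bij (fun c _ => extendTab n c.1 h c.2) ?_ ?_ ?_ ?_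
  · rintro ⟨γ, s⟩ hc
    simp only [Finset.mem_sigma, Finset.mem_filter] at hc
    exact extendTab_mem hc.1.2.2 hc.1.2.1 hc.1.1 hc.2
  · rintro ⟨γ, s⟩ hc ⟨γ', s'⟩ hc' he
    simp only [Finset.mem_sigma, Finset.mem_filter] at hc hc'
    obtain rfl : γ = γ' := le_antisymm
      (extendTab_injective hl0 hd hc'.1.2.2 (hle hc.1.1) hc.2 he.symm)
      (extendTab_injective hl0 hd hc.1.2.2 (hle hc'.1.1) hc'.2 he)
    congr 1
    ext p
    have h1 := congrFun he p
    unfold extendTab at h1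
    dsimp only at h1
    by_cases hp : InCols γ h p
    · rw [(mem_colTab.1 hc.2).2.1 p fun hq => hq.2.not_ge hp.1,
        (mem_colTab.1 hc'.2).2.1 p fun hq => hq.2.not_ge hp.1]
    · rwa [if_neg hp, if_neg hp] at h1
  · intro t ht
    obtain ⟨γ, h1, h2, h3, s, hs, he⟩ := exists_extendTab hl hl0 hlh hh hd ht
    exact ⟨⟨γ, s⟩, Finset.mem_sigma.2 ⟨Finset.mem_filter.2 ⟨h1, h2, h3⟩, hs⟩, he⟩
  · rintro ⟨γ, s⟩ hc
    simp only [Finset.mem_sigma, Finset.mem_filter] at hc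
    exact (tabWt_extendTab hc.1.2.2 (hle hc.1.1) hl0 hd).symm

/-- The Jacobi–Trudi formula for supersymmetric tableaux with weights depending on the colour and
the diagonal of a cell. -/
lemma sum_colTab_eq_colDet (hl : Antitone l) (hl0 : ∀ j, 0 ≤ l j) (hlh : l ≤ h)
    (hh : Antitone h) (hd : ∀ j, h j ≤ d) :
    ∑ t ∈ colTab r d n l h, tabWt x l h t = colDet r x n l h := by
  induction n generalizing h with
  | zero =>
    rcases hlh.eq_or_lt with rfl | hlt
    · rw [colDet_zero_self hl, Finset.sum_eq_single 0]
      · exact Finset.prod_eq_one fun p _ => if_neg fun hp => hp.1.not_gt hp.2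
      · intro t ht hne
        exact absurd (funext fun p => (mem_colTab.1 ht).2.1 p fun hp => hp.1.not_gt hp.2) hne
      · intro hne
        exact absurd (mem_colTab.2 ⟨fun p hp => absurd hp.2 hp.1.not_gt, fun _ _ => rfl,
          fun p q hp => absurd hp.2 hp.1.not_gt⟩) hne
    · obtain ⟨p, hp⟩ := (Pi.lt_def.1 hlt).2
      rw [colDet_zero_of_lt hl hh hp]
      refine Finset.sum_eq_zero fun t ht => ?_
      have h1 := hl0 p
      have h2 := hd p
      exact absurd ((mem_colTab.1 ht).1 (⟨(l p).toNat, by omega⟩, p)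
        (by unfold InCols; dsimp only; omega)) (Nat.not_lt_zero _)
  | succ n ih =>
    rw [sum_colTab_succ hl hl0 hlh hh hd, colDet_succ n hl0 hh, Finset.sum_filter]
    refine Finset.sum_congr rfl fun γ hγ => ?_
    have hb : ∀ j, (if n ≤ r then h j - 1 else nextHeight h j) ≤ γ j ∧ γ j ≤ h j :=
      fun j => Finset.mem_Icc.1 (Fintype.mem_piFinset.1 hγ j)
    split_ifs with hc
    · rw [ih hc.2 hc.1 fun j => (hb j).2.trans (hd j)]
    · symm
      refine mul_eq_zero_of_right _ ?_
      by_cases hanti : Antitone γ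
      · obtain ⟨p, hp⟩ : ∃ p, γ p < l p := by
          by_contra! hcon
          exact hc ⟨hanti, hcon⟩
        exact colDet_eq_zero_of_lt n hl hanti hp
      · obtain ⟨i, j, hij, hlt⟩ : ∃ i j : Fin k, j.1 = i.1 + 1 ∧ γ i < γ j := by
          by_contra! hcon
          exact hanti (antitone_of_adjacent hcon)
        have h1 := hb i
        have h2 := hb j
        have h3 : h j ≤ h i := hh (show i.1 ≤ j.1 by omega)
        by_cases hn : n ≤ r
        · rw [if_pos hn] at h1 h2
          exact colDet_eq_zero_of_step n hij (by omega)
        · rw [if_neg hn, nextHeight_of_adjacent hij] at h1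
          omega

end tableaux

/-- The normalisation of a column on the diagonals `b < m ≤ a` with vacuum function `G`. -/
def vacF (G : ℤ → ℂ) (b a : ℤ) : ℂ := if a = b then (G (a + 1))⁻¹ else stripWt G (b + 1) a

/-- The normalised generating function of a column. -/
def normCol (G : ℤ → ℂ) (S : ℤ → ℤ → ℂ) (b a : ℤ) : ℂ :=
  if a < b then 0 else if a = b then G (a + 1) else (stripWt G (b + 1) a)⁻¹ * S b a

/-- The multiplicity of `G m` in `vacF G b a`. -/
def vacMult (m b a : ℤ) : ℤ := (if m ≤ a then 1 else 0) - if m ≤ b + 1 then 1 else 0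

section normalisation

variable {G : ℤ → ℂ} {S : ℤ → ℤ → ℂ} {a b m : ℤ}

lemma vacMult_pos : 0 < vacMult m b a ↔ b + 1 < m ∧ m ≤ a := by
  unfold vacMult
  split_ifs <;> omega

lemma vacMult_neg : vacMult m b a < 0 ↔ a < m ∧ m ≤ b + 1 := by
  unfold vacMult
  split_ifs <;> omega

lemma vacF_eq_zero (h : vacF G b a = 0) : ∃ m, vacMult m b a ≠ 0 ∧ G m = 0 := by
  unfold vacF at h
  split_ifs at h with hab
  · exact ⟨a + 1, (vacMult_neg.2 (by omega)).ne, inv_eq_zero.1 h⟩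
  · obtain ⟨m, hm, hG⟩ := Finset.prod_eq_zero_iff.1 h
    rw [Finset.mem_Ioc] at hm
    exact ⟨m, (vacMult_pos.2 hm).ne', hG⟩

lemma normCol_eq_zero (hm : vacMult m b a ≠ 0) (hG : G m = 0) :
    normCol G S b a = 0 := by
  unfold normCol
  split_ifs with h1 h2
  · rfl
  · rcases hm.lt_or_gt with h | h
    · rw [vacMult_neg] at h
      rwa [show a + 1 = m by omega]
    · rw [vacMult_pos] at h
      omega
  · rcases hm.lt_or_gt with h | h
    · rw [vacMult_neg] at h
      omega
    · rw [vacMult_pos] at h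
      rw [stripWt, Finset.prod_eq_zero (Finset.mem_Ioc.2 h) hG, inv_zero, zero_mul]

lemma vacF_eq_div {M : ℤ} (hM : M ≤ b) (hba : b ≤ a) (h0 : vacF G b a ≠ 0) :
    vacF G b a = stripWt (fun m => if G m = 0 then 1 else G m) M a /
      stripWt (fun m => if G m = 0 then 1 else G m) M (b + 1) := by
  have hne : ∀ g c, stripWt (fun m => if G m = 0 then 1 else G m) g c ≠ 0 := fun g c =>
    Finset.prod_ne_zero_iff.2 fun m _ => by
      split_ifs with hG
      · exact one_ne_zero
      · exact hG
  rw [eq_div_iff (hne _ _)]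
  unfold vacF at h0 ⊢
  split_ifs at h0 ⊢ with hab
  · subst hab
    have hG : G (a + 1) ≠ 0 := fun hG => h0 (by rw [hG, inv_zero])
    rw [← stripWt_mul _ hM (show a ≤ a + 1 by omega), mul_comm, mul_assoc]
    have hone : stripWt (fun m => if G m = 0 then 1 else G m) a (a + 1) = G (a + 1) := by
      rw [stripWt, show Finset.Ioc a (a + 1) = {a + 1} from by
        ext y
        simp only [Finset.mem_Ioc, Finset.mem_singleton]
        omega, Finset.prod_singleton, if_neg hG]
    rw [hone, mul_inv_cancel₀ hG, mul_one]
  · rw [← stripWt_mul _ (show M ≤ b + 1 by omega) (show b + 1 ≤ a by omega), mul_comm]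
    congr 1
    refine Finset.prod_congr rfl fun m hm => ?_
    exact (if_neg (Finset.prod_ne_zero_iff.1 h0 m hm)).symm

variable {k : ℕ} {α β : Fin k → ℤ}

lemma sum_vacMult_perm (m : ℤ) (σ : Equiv.Perm (Fin k)) :
    ∑ i, vacMult m (β i) (α (σ i)) = ∑ i, vacMult m (β i) (α i) := by
  simp only [vacMult, Finset.sum_sub_distrib]
  rw [Equiv.sum_comp σ fun i => if m ≤ α i then (1 : ℤ) else 0]

lemma sum_vacMult_ne_zero (hα : StrictAnti α) (hβ : StrictAnti β) {i : Fin k}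
    (hi : vacMult m (β i) (α i) ≠ 0) : ∑ i, vacMult m (β i) (α i) ≠ 0 := by
  have hsign : ∀ p q, 0 < vacMult m (β p) (α p) → ¬ vacMult m (β q) (α q) < 0 := by
    intro p q hp hq
    rw [vacMult_pos] at hp
    rw [vacMult_neg] at hq
    rcases le_total p q with hpq | hpq
    · have h1 := hβ.antitone hpq
      omega
    · have h1 := hα.antitone hpq
      omega
  rcases hi.lt_or_gt with h | h
  · refine (Finset.sum_neg' (fun q _ => ?_) ⟨i, Finset.mem_univ _, h⟩).ne
    exact not_lt.1 fun hq => hsign q i hq h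
  · refine (Finset.sum_pos' (fun q _ => ?_) ⟨i, Finset.mem_univ _, h⟩).ne'
    exact not_lt.1 (hsign i q h)

lemma prod_normCol (hS0 : ∀ b a, a < b → S b a = 0) (hS1 : ∀ b, S b b = 1)
    (hSG : ∀ b a m, b + 1 < m → m ≤ a → G m = 0 → S b a = 0)
    (hα : StrictAnti α) (hβ : StrictAnti β) (hβα : β ≤ α) (σ : Equiv.Perm (Fin k)) :
    (∏ i, vacF G (β i) (α i))⁻¹ * ∏ i, S (β i) (α (σ i)) =
      ∏ i, normCol G S (β i) (α (σ i)) := by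
  by_cases hneg : ∃ i, α (σ i) < β i
  · obtain ⟨i, hi⟩ := hneg
    rw [Finset.prod_eq_zero (f := fun i => S (β i) (α (σ i))) (Finset.mem_univ i)
        (hS0 _ _ hi), mul_zero,
      Finset.prod_eq_zero (f := fun i => normCol G S (β i) (α (σ i))) (Finset.mem_univ i)
        (if_pos hi)]
  push Not at hneg
  by_cases hF : ∏ i, vacF G (β i) (α i) = 0
  · rw [hF, inv_zero, zero_mul]
    obtain ⟨i, _, hi⟩ := Finset.prod_eq_zero_iff.1 hF
    obtain ⟨m, hm, hG⟩ := vacF_eq_zero hi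
    have hsum := sum_vacMult_ne_zero hα hβ hm
    rw [← sum_vacMult_perm m σ] at hsum
    obtain ⟨q, hq, hqm⟩ := Finset.exists_ne_zero_of_sum_ne_zero hsum
    exact (Finset.prod_eq_zero hq (normCol_eq_zero hqm hG)).symm
  have hid : ∀ m i, G m = 0 → vacMult m (β i) (α i) = 0 := by
    intro m i hG
    by_contra hm
    refine hF (Finset.prod_eq_zero (Finset.mem_univ i) ?_)
    unfold vacF
    rcases (Ne.lt_or_gt hm) with h | h
    · rw [vacMult_neg] at h
      have : β i ≤ α i := hβα i
      rw [if_pos (by omega), show α i + 1 = m by omega, hG, inv_zero]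
    · rw [vacMult_pos] at h
      rw [if_neg (by omega), stripWt, Finset.prod_eq_zero (Finset.mem_Ioc.2 h) hG]
  by_cases hbad : ∃ m i, G m = 0 ∧ vacMult m (β i) (α (σ i)) ≠ 0
  · obtain ⟨m, i, hG, hm⟩ := hbad
    rw [Finset.prod_eq_zero (f := fun i => normCol G S (β i) (α (σ i))) (Finset.mem_univ i)
      (normCol_eq_zero hm hG)]
    obtain ⟨q, hq⟩ : ∃ q, 0 < vacMult m (β q) (α (σ q)) := by
      by_contra! hcon
      have hlt := Finset.sum_neg' (fun q _ => hcon q)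
        ⟨i, Finset.mem_univ _, lt_of_le_of_ne (hcon i) hm⟩
      rw [sum_vacMult_perm, Finset.sum_eq_zero fun q _ => hid m q hG] at hlt
      exact lt_irrefl _ hlt
    rw [vacMult_pos] at hq
    exact mul_eq_zero_of_right _
      (Finset.prod_eq_zero (Finset.mem_univ q) (hSG _ _ m hq.1 hq.2 hG))
  · push Not at hbad
    have hne : ∀ i, vacF G (β i) (α (σ i)) ≠ 0 := fun i h => by
      obtain ⟨m, hm, hG⟩ := vacF_eq_zero h
      exact hm (hbad m i hG)
    have hfac : ∀ i, S (β i) (α (σ i)) =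
        vacF G (β i) (α (σ i)) * normCol G S (β i) (α (σ i)) := by
      intro i
      have h0 := hne i
      unfold normCol
      rw [if_neg (hneg i).not_gt]
      unfold vacF at h0 ⊢
      split_ifs at h0 ⊢ with h
      · rw [h] at h0 ⊢
        rw [hS1, inv_mul_cancel₀ fun hG => h0 (by rw [hG, inv_zero])]
      · rw [mul_inv_cancel_left₀ h0]
    obtain ⟨M, hM⟩ : ∃ M, ∀ i, M ≤ β i := by
      obtain ⟨M, hM⟩ := (Set.finite_range β).bddBelow
      exact ⟨M, fun i => hM ⟨i, rfl⟩⟩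
    have hFσ : ∏ i, vacF G (β i) (α (σ i)) = ∏ i, vacF G (β i) (α i) := by
      rw [Finset.prod_congr rfl fun i _ => vacF_eq_div (hM i) (hneg i) (hne i),
        Finset.prod_congr rfl fun i _ => vacF_eq_div (hM i) (hβα i)
          (Finset.prod_ne_zero_iff.1 hF i (Finset.mem_univ i)),
        Finset.prod_div_distrib, Finset.prod_div_distrib]
      rw [Equiv.prod_comp σ fun i => stripWt (fun m => if G m = 0 then 1 else G m) M (α i)]
    rw [Finset.prod_congr rfl fun i _ => hfac i, Finset.prod_mul_distrib, hFσ,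
      inv_mul_cancel_left₀ hF]

/-- The normalisations are compatible with every term of a Jacobi–Trudi determinant. -/
lemma det_normCol (hS0 : ∀ b a, a < b → S b a = 0) (hS1 : ∀ b, S b b = 1)
    (hSG : ∀ b a m, b + 1 < m → m ≤ a → G m = 0 → S b a = 0)
    (hα : StrictAnti α) (hβ : StrictAnti β) (hβα : β ≤ α) :
    (∏ i, vacF G (β i) (α i))⁻¹ * Matrix.det (Matrix.of fun i j => S (β j) (α i)) =
      Matrix.det (Matrix.of fun i j => normCol G S (β j) (α i)) := by
  rw [Matrix.det_apply, Matrix.det_apply, Finset.mul_sum]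
  refine Finset.sum_congr rfl fun σ _ => ?_
  rw [mul_smul_comm]
  congr 1
  exact prod_normCol hS0 hS1 hSG hα hβ hβα σ

end normalisation

lemma le_card_filter_iff {d i : ℕ} {P : ℕ → Prop} [DecidablePred P]
    (hP : ∀ i j, 1 ≤ i → i ≤ j → P j → P i) (h1 : 1 ≤ i) (hi : i ≤ d) :
    i ≤ ((Finset.Icc 1 d).filter P).card ↔ P i := by
  refine ⟨fun hcard => ?_, fun hPi => ?_⟩
  · by_contra hPi
    have hsub : (Finset.Icc 1 d).filter P ⊆ Finset.Icc 1 (i - 1) := fun q hq => by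
      simp only [Finset.mem_filter, Finset.mem_Icc] at hq ⊢
      have : ¬ i ≤ q := fun hiq => hPi (hP i q h1 hiq hq.2)
      omega
    have := Finset.card_le_card hsub
    rw [Nat.card_Icc] at this
    omega
  · have hsub : Finset.Icc 1 i ⊆ (Finset.Icc 1 d).filter P := fun q hq => by
      simp only [Finset.mem_filter, Finset.mem_Icc] at hq ⊢
      exact ⟨⟨hq.1, hq.2.trans hi⟩, hP q i hq.1 hq.2 hPi⟩
    have := Finset.card_le_card hsub
    rw [Nat.card_Icc] at this
    omega

lemma Skew.conjLam_le_conjMu (D : Skew) (j : ℕ) : D.conjLam j ≤ D.conjMu j :=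
  Finset.card_le_card (Finset.monotone_filter_right _ fun i _ hi => le_trans hi (D.sub i))

lemma Skew.conjMu_le (D : Skew) (j : ℕ) : D.conjMu j ≤ D.d :=
  (Finset.card_filter_le _ _).trans (by rw [Nat.card_Icc, Nat.add_sub_cancel])

lemma Skew.conjMu_antitone (D : Skew) : Antitone D.conjMu := fun _ _ h =>
  Finset.card_le_card (Finset.monotone_filter_right _ fun _ _ hi => le_trans h hi)

lemma Skew.conjLam_antitone (D : Skew) : Antitone D.conjLam := fun _ _ h =>
  Finset.card_le_card (Finset.monotone_filter_right _ fun _ _ hi => le_trans h hi)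

lemma Skew.cell_iff (D : Skew) {i : ℕ} (hi : i < D.d) (j : ℕ) :
    D.cell (i + 1) (j + 1) ↔ D.conjLam (j + 1) ≤ i ∧ i < D.conjMu (j + 1) := by
  have h1 := le_card_filter_iff (d := D.d) (i := i + 1) (P := fun i => j + 1 ≤ D.lam i)
    (fun p q hp hpq hq => le_trans hq (D.lam_anti p q hp hpq)) (by omega) (by omega)
  have h2 := le_card_filter_iff (d := D.d) (i := i + 1) (P := fun i => j + 1 ≤ D.mu i)
    (fun p q hp hpq hq => le_trans hq (D.mu_anti p q hp hpq)) (by omega) (by omega)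
  unfold Skew.cell Skew.conjLam Skew.conjMu
  omega

/-- The heights of the columns of `λ`. -/
def Skew.lower (D : Skew) (j : Fin (D.mu 1)) : ℤ := D.conjLam (j.1 + 1)

/-- The heights of the columns of `μ`. -/
def Skew.upper (D : Skew) (j : Fin (D.mu 1)) : ℤ := D.conjMu (j.1 + 1)

lemma Skew.lower_antitone (D : Skew) : Antitone D.lower := fun _ _ h =>
  Int.ofNat_le.2 (D.conjLam_antitone (Nat.succ_le_succ h))

lemma Skew.upper_antitone (D : Skew) : Antitone D.upper := fun _ _ h =>
  Int.ofNat_le.2 (D.conjMu_antitone (Nat.succ_le_succ h))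

lemma Skew.lower_le_upper (D : Skew) : D.lower ≤ D.upper := fun j =>
  Int.ofNat_le.2 (D.conjLam_le_conjMu (j.1 + 1))

lemma Skew.cell_iff_inCols (D : Skew) (p : Fin D.d × Fin (D.mu 1)) :
    D.cell (p.1.1 + 1) (p.2.1 + 1) ↔ InCols D.lower D.upper p := by
  rw [D.cell_iff p.1.2]
  unfold InCols Skew.lower Skew.upper
  omega

/-- The signed weight of a box of colour `c + 1` on the diagonal `m`. -/
def boxWt (r s : ℕ) (η : ℂ) (Nb : ℕ → ℕ) (rt : ℕ → ℕ → ℂ) (N : ℕ) (w : ℕ → ℂ) (C : ℂ)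
    (c : ℕ) (m : ℤ) : ℂ :=
  sgn r (c + 1) * zf r s η Nb rt N w (c + 1) (C - 2 * (m : ℂ) + 2)

/-- The vacuum factor of a box on the diagonal `m`. -/
def diagVac (η : ℂ) (N : ℕ) (w : ℕ → ℂ) (C : ℂ) (m : ℤ) : ℂ := Pf η N w (C - 2 * (m : ℂ) + 2)

section dressedVacuum

variable (r s : ℕ) (η : ℂ) (Nb : ℕ → ℕ) (rt : ℕ → ℕ → ℂ) (N : ℕ) (w : ℕ → ℂ)

lemma boxWt_eq_zero (C : ℂ) (c : ℕ) (m : ℤ) (hc : c ≠ 0) (hm : diagVac η N w C m = 0) :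
    boxWt r s η Nb rt N w C c m = 0 := by
  have hψ : ψf η N w (c + 1) (C - 2 * (m : ℂ) + 2) = 0 := by
    rw [ψf, if_neg (by omega)]
    exact hm
  unfold boxWt zf
  rw [hψ]
  simp

lemma Tskew_eq_colDet (D : Skew) (u : ℂ) :
    Tskew r s η Nb rt N w D u = (Fskew η N w D u)⁻¹ *
      colDet r (boxWt r s η Nb rt N w (u - (D.mu 1 : ℂ) + (D.conjMu 1 : ℂ))) (r + s + 2)
        D.lower D.upper := by
  rw [← sum_colTab_eq_colDet (d := D.d) D.lower_antitone (fun _ => Int.natCast_nonneg _)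
    D.lower_le_upper D.upper_antitone (fun j => Int.ofNat_le.2 (D.conjMu_le _)), Tskew]
  congr 1
  refine Finset.sum_bij (fun t _ p => (t p : ℕ)) ?_ ?_ ?_ ?_
  · intro t ht
    obtain ⟨ht1, ht2⟩ := (Finset.mem_filter.1 ht).2
    refine mem_colTab.2 ⟨fun p _ => (t p).2, fun p hp => ?_, fun p q hp hq => ?_⟩
    · exact ht1 p (by rwa [D.cell_iff_inCols])
    · exact ht2 p q ((D.cell_iff_inCols p).2 hp) ((D.cell_iff_inCols q).2 hq)
  · intro t _ t' _ he
    exact funext fun p => Fin.ext (congrFun he p)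
  · intro t ht
    obtain ⟨ht1, ht2, ht3⟩ := mem_colTab.1 ht
    have hlt : ∀ p, t p < r + s + 2 := fun p => by
      by_cases hp : InCols D.lower D.upper p
      · exact ht1 p hp
      · rw [ht2 p hp]
        omega
    refine ⟨fun p => ⟨t p, hlt p⟩, Finset.mem_filter.2 ⟨Finset.mem_univ _, fun p hp => ?_,
      fun p q hp hq => ?_⟩, rfl⟩
    · exact ht2 p (by rwa [← D.cell_iff_inCols])
    · exact ht3 p q ((D.cell_iff_inCols p).1 hp) ((D.cell_iff_inCols q).1 hq)
  · intro t _
    refine Finset.prod_congr rfl fun p _ => ?_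
    simp only [D.cell_iff_inCols]
    split_ifs
    · unfold boxWt
      congr 2
      push_cast
      ring
    · rfl

lemma Fa_eq_vacF (C : ℂ) {a b : ℤ} (hba : b ≤ a) :
    Fa η N w (a - b).toNat (C - a - b + 1) = vacF (diagVac η N w C) b a := by
  have hcast : (((a - b).toNat : ℕ) : ℂ) = (a : ℂ) - b := by
    have : (((a - b).toNat : ℕ) : ℤ) = a - b := Int.toNat_of_nonneg (by omega)
    exact_mod_cast congrArg (Int.cast : ℤ → ℂ) this
  unfold Fa vacF
  rcases hba.eq_or_lt with rfl | hlt
  · rw [if_pos (by omega), if_pos rfl, one_div, diagVac]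
    congr 2
    push_cast
    ring
  · rw [if_neg (by omega), if_neg (by omega), stripWt]
    refine Finset.prod_bij (fun j _ => b + 1 + (j : ℤ)) ?_ ?_ ?_ ?_
    · intro j hj
      rw [Finset.mem_Icc] at hj
      rw [Finset.mem_Ioc]
      omega
    · intro j _ j' _ he
      omega
    · intro m hm
      rw [Finset.mem_Ioc] at hm
      exact ⟨(m - b - 1).toNat, Finset.mem_Icc.2 (by omega), by omega⟩
    · intro j _
      unfold diagVac
      congr 1
      rw [hcast]
      push_cast
      ring

lemma Fskew_eq_prod_vacF (D : Skew) (u : ℂ) :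
    Fskew η N w D u = ∏ j : Fin (D.mu 1),
      vacF (diagVac η N w (u - (D.mu 1 : ℂ) + (D.conjMu 1 : ℂ)))
        (D.lower j - (j.1 : ℤ)) (D.upper j - (j.1 : ℤ)) := by
  have hIcc : Finset.Icc 1 (D.mu 1) = (Finset.range (D.mu 1)).image (· + 1) := by
    ext q
    simp only [Finset.mem_Icc, Finset.mem_image, Finset.mem_range]
    exact ⟨fun h => ⟨q - 1, by omega, by omega⟩, by rintro ⟨p, hp, rfl⟩; omega⟩
  rw [Fskew, hIcc, Finset.prod_image fun _ _ _ _ h => by simpa using h, Finset.prod_range]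
  refine Finset.prod_congr rfl fun j _ => ?_
  have h1 : D.lower j ≤ D.upper j := D.lower_le_upper j
  rw [← Fa_eq_vacF η N w _ (by omega)]
  unfold Skew.lower Skew.upper
  congr 1
  · omega
  · push_cast
    ring

lemma colDet_of_single_column {x : ℕ → ℤ → ℂ} {k : ℕ} (hk : k = 1) {l h : Fin k → ℤ}
    {n : ℕ} {a b : ℤ} (hl : ∀ j, l j = b) (hh : ∀ j, h j = a) :
    colDet r x n l h = colGen r x n b a := by
  subst hk
  rw [colDet, Matrix.det_fin_one, Matrix.of_apply, hl, hh]
  simp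

lemma TaA_eq_normCol (C : ℂ) (a b : ℤ) :
    TaA r s η Nb rt N w (a - b) (C - a - b + 1) =
      normCol (diagVac η N w C) (colGen r (boxWt r s η Nb rt N w C) (r + s + 2)) b a := by
  unfold TaA normCol
  rcases lt_trichotomy a b with hlt | rfl | hgt
  · rw [if_pos (by omega), if_pos hlt]
  · rw [if_neg (by omega), if_pos (by omega), if_neg (lt_irrefl _), if_pos rfl, diagVac]
    congr 1
    push_cast
    ring
  · rw [if_neg (by omega), if_neg (by omega), if_neg (by omega), if_neg (by omega)]
    obtain ⟨n, hn⟩ : ∃ n, n = (a - b).toNat := ⟨_, rfl⟩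
    rw [← hn]
    have hn1 : 1 ≤ n := by omega
    have hab : a = n + b := by omega
    have hcast : (a : ℂ) = n + b := by rw [hab]; push_cast; rfl
    have hmu : (rect n 1).mu 1 = 1 := if_pos ⟨le_rfl, hn1⟩
    have hconj : (rect n 1).conjMu 1 = n := by
      unfold Skew.conjMu
      rw [Finset.filter_true_of_mem, Nat.card_Icc]
      · simp [rect]
      · intro i hi
        exact (if_pos (Finset.mem_Icc.1 hi)).ge
    have hlam : (rect n 1).conjLam 1 = 0 := by
      simp [Skew.conjLam, rect]
    have hj : ∀ j : Fin ((rect n 1).mu 1), j.1 = 0 := fun j => by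
      have := j.2
      omega
    rw [Tskew_eq_colDet, colDet_of_single_column (a := n) (b := 0) r hmu
      (fun j => by rw [Skew.lower, hj j]; exact congrArg _ hlam)
      (fun j => by rw [Skew.upper, hj j]; exact congrArg _ hconj)]
    refine congrArg₂ _ (congrArg _ ?_) ?_
    · have hF := Fa_eq_vacF η N w C hgt.le
      rw [vacF, if_neg hgt.ne', ← hn] at hF
      rw [← hF, Fskew, hmu, Finset.Icc_self, Finset.prod_singleton, hconj, hlam]
      congr 1
      rw [hcast]
      push_cast
      ring
    · rw [show colGen r (boxWt r s η Nb rt N w C) (r + s + 2) b a =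
        colGen r (boxWt r s η Nb rt N w C) (r + s + 2) (0 + b) (n + b) by rw [zero_add, hab],
        ← colGen_shift]
      congr 1
      funext c m
      unfold boxWt
      congr 2
      rw [hmu, hconj, hcast]
      push_cast
      ring

end dressedVacuum

/-- Quantum Jacobi–Trudi formula, column form:  for every
skew Young diagram `λ ⊂ μ`,
`𝒯_{λ⊂μ}(u) = det_{1≤i,j≤μ_1}(𝒯^{μ′_i−λ′_j−i+j}(u−μ_1+μ′_1−μ′_i−λ′_j+i+j−1))`. -/
theorem quantum_jacobi_trudi_col
    (r s : ℕ) (η : ℂ) (hη : Complex.exp (2 * η) ≠ 1)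
    (Nb : ℕ → ℕ) (rt : ℕ → ℕ → ℂ) (N : ℕ) (w : ℕ → ℂ)
    (D : Skew) (u : ℂ) :
    Tskew r s η Nb rt N w D u =
      Matrix.det (Matrix.of fun i j : Fin (D.mu 1) =>
        TaA r s η Nb rt N w
          ((D.conjMu (i.1 + 1) : ℤ) - (D.conjLam (j.1 + 1) : ℤ) - (i.1 + 1) + (j.1 + 1))
          (u - (D.mu 1 : ℂ) + (D.conjMu 1 : ℂ) - (D.conjMu (i.1 + 1) : ℂ)
            - (D.conjLam (j.1 + 1) : ℂ) + ((i.1 : ℂ) + 1) + ((j.1 : ℂ) + 1) - 1)) := by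
  have hstrict : ∀ {f : Fin (D.mu 1) → ℤ}, Antitone f →
      StrictAnti fun i : Fin (D.mu 1) => f i - (i.1 : ℤ) := fun hf i j hij => by
    have h1 := hf hij.le
    have h2 : i.1 < j.1 := hij
    dsimp only
    omega
  rw [Tskew_eq_colDet, Fskew_eq_prod_vacF, colDet,
    det_normCol (G := diagVac η N w (u - (D.mu 1 : ℂ) + (D.conjMu 1 : ℂ)))
      (S := colGen r (boxWt r s η Nb rt N w (u - (D.mu 1 : ℂ) + (D.conjMu 1 : ℂ))) (r + s + 2))
      (α := fun i : Fin (D.mu 1) => D.upper i - (i.1 : ℤ))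
      (β := fun i : Fin (D.mu 1) => D.lower i - (i.1 : ℤ))
      (fun _ _ h => colGen_of_lt _ h) (fun _ => colGen_self _ _)
      (fun b a m h1 h2 hG => colGen_eq_zero_of_vacuum (boxWt_eq_zero r s η Nb rt N w _) _
        (Finset.mem_Ioc.2 ⟨h1, h2⟩) hG)
      (hstrict D.upper_antitone) (hstrict D.lower_antitone)
      (fun i => sub_le_sub_right (D.lower_le_upper i) _)]
  congr 1
  ext i j
  rw [Matrix.of_apply, Matrix.of_apply, ← TaA_eq_normCol]
  unfold Skew.lower Skew.upper
  congr 1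
  · ring
  · push_cast
    ring

end Tsuboi
end
end

section
/- Assume the trivial vacuum, i.e., N = 0 so that P_1 ≡ 1. For l ≥ 0 define A^l(v) := Σ_{1≤c_1<⋯<c_l≤r+1} ∏_{i=1}^{l} z(c_i; v+l+1−2i) (with A^0 := 1, A^l := 0 for l > r+1), B_k(v) := (−1)^k Σ_{r+2≤d_1≤⋯≤d_k≤r+s+2} ∏_{i=1}^{k} z(d_i; v+k+1−2i) (with B_0 := 1), A_k(v) := Σ_{1≤c_1≤⋯≤c_k≤r+1} ∏_{i=1}^{k} z(c_i; v−k−1+2i) (with A_0 := 1), and B^l(v) := (−1)^l Σ_{r+2≤d_1<⋯<d_l≤r+s+2} ∏_{i=1}^{l} z(d_i; v−l−1+2i) (with B^0 := 1, B^l := 0 for l > s+1). Then for all a, m ≥ 1: T^a(u) = Σ_{l=0}^{min(r+1,a)} B_{a−l}(u−l)·A^l(u+a−l) and T_m(u) = Σ_{l=0}^{min(s+1,m)} A_{m−l}(u−l)·B^l(u+m−l), where T^a(u) := Σ_{b_1 ≼ … ≼ b_a} ∏_{i=1}^{a} (−1)^{p(b_i)} z(b_i; u+a+1−2i) (sum over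 weakly increasing sequences in J with no repeated J₊ entry) and T_m(u) := Σ_{b_1 ≼ … ≼ b_m} ∏_{j=1}^{m} (−1)^{p(b_j)} z(b_j; u−m−1+2j) (sum over weakly increasing sequences in J with no repeated J₋ entry). -/
/-!
Analytic Bethe ansatz for the Lie superalgebra `sl(r+1|s+1)` (Z. Tsuboi,
J. Phys. A: Math. Gen. 30 (1997) 7975-7991).  Common definitions.
-/

open scoped Classical
open Filter Topology

noncomputable section

namespace Tsuboi

/-- `𝒜^l(v)`: sum over strictly increasing sequences in `J₊` (entry `c i + 1`). -/
def Afun (r s : ℕ) (η : ℂ) (Nb : ℕ → ℕ) (rt : ℕ → ℕ → ℂ) (l : ℕ) (v : ℂ) : ℂ :=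
  ∑ c ∈ Finset.univ.filter (fun c : Fin l → Fin (r + 1) =>
      ∀ (i : ℕ) (h : i + 1 < l), (c ⟨i, by omega⟩ : ℕ) < (c ⟨i + 1, h⟩ : ℕ)),
    ∏ i : Fin l,
      zf r s η Nb rt 0 (fun _ => 0) ((c i : ℕ) + 1)
        (v + (l : ℂ) + 1 - 2 * ((i.1 : ℂ) + 1))

/-- `ℬ_k(v)`: `(−1)^k` times the sum over weakly increasing sequences in `J₋`
(entry `d i + r + 2`). -/
def Bdown (r s : ℕ) (η : ℂ) (Nb : ℕ → ℕ) (rt : ℕ → ℕ → ℂ) (k : ℕ) (v : ℂ) : ℂ :=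
  (-1 : ℂ) ^ k *
    ∑ d ∈ Finset.univ.filter (fun d : Fin k → Fin (s + 1) =>
        ∀ (i : ℕ) (h : i + 1 < k), (d ⟨i, by omega⟩ : ℕ) ≤ (d ⟨i + 1, h⟩ : ℕ)),
      ∏ i : Fin k,
        zf r s η Nb rt 0 (fun _ => 0) ((d i : ℕ) + r + 2)
          (v + (k : ℂ) + 1 - 2 * ((i.1 : ℂ) + 1))

/-- `𝒜_k(v)`: sum over weakly increasing sequences in `J₊`. -/
def Adown (r s : ℕ) (η : ℂ) (Nb : ℕ → ℕ) (rt : ℕ → ℕ → ℂ) (k : ℕ) (v : ℂ) : ℂ :=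
  ∑ c ∈ Finset.univ.filter (fun c : Fin k → Fin (r + 1) =>
      ∀ (i : ℕ) (h : i + 1 < k), (c ⟨i, by omega⟩ : ℕ) ≤ (c ⟨i + 1, h⟩ : ℕ)),
    ∏ i : Fin k,
      zf r s η Nb rt 0 (fun _ => 0) ((c i : ℕ) + 1)
        (v - (k : ℂ) - 1 + 2 * ((i.1 : ℂ) + 1))

/-- `ℬ^l(v)`: `(−1)^l` times the sum over strictly increasing sequences in `J₋`. -/
def Bup (r s : ℕ) (η : ℂ) (Nb : ℕ → ℕ) (rt : ℕ → ℕ → ℂ) (l : ℕ) (v : ℂ) : ℂ :=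
  (-1 : ℂ) ^ l *
    ∑ d ∈ Finset.univ.filter (fun d : Fin l → Fin (s + 1) =>
        ∀ (i : ℕ) (h : i + 1 < l), (d ⟨i, by omega⟩ : ℕ) < (d ⟨i + 1, h⟩ : ℕ)),
      ∏ i : Fin l,
        zf r s η Nb rt 0 (fun _ => 0) ((d i : ℕ) + r + 2)
          (v - (l : ℂ) - 1 + 2 * ((i.1 : ℂ) + 1))

/-- The sum of `∏ i < n, f i (b i)` over the sequences `b` of length `n` whose consecutive
entries are `R`-related and whose first entry (if any) satisfies `P`. -/
def chainSum {ι : Type*} [Fintype ι] (R : ι → ι → Prop) :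
    ℕ → (ℕ → ι → ℂ) → (ι → Prop) → ℂ
  | 0, _, _ => 1
  | n + 1, f, P => ∑ x, if P x then f 0 x * chainSum R n (fun i => f (i + 1)) (R x) else 0

theorem sum_filter_eq_chainSum {ι : Type*} [Fintype ι] (R : ι → ι → Prop) (n : ℕ)
    (f : ℕ → ι → ℂ) (P : ι → Prop) :
    (∑ b : Fin n → ι, if (∀ h : 0 < n, P (b ⟨0, h⟩)) ∧
        ∀ (i : ℕ) (h : i + 1 < n), R (b ⟨i, by omega⟩) (b ⟨i + 1, h⟩)
      then ∏ i : Fin n, f i (b i) else 0) = chainSum R n f P := by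
  induction n generalizing f P with
  | zero => simp [chainSum]
  | succ n ih =>
    rw [chainSum, ← (Fin.consEquiv fun _ => ι).sum_comp, Fintype.sum_prod_type]
    refine Finset.sum_congr rfl fun x _ => ?_
    have key (b : Fin n → ι) : (∀ (i : ℕ) (h : i + 1 < n + 1),
          R ((Fin.cons x b : Fin (n + 1) → ι) ⟨i, by omega⟩)
            ((Fin.cons x b : Fin (n + 1) → ι) ⟨i + 1, h⟩)) ↔
        (∀ h : 0 < n, R x (b ⟨0, h⟩)) ∧
          ∀ (i : ℕ) (h : i + 1 < n), R (b ⟨i, by omega⟩) (b ⟨i + 1, h⟩) := by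
      constructor
      · exact fun H => ⟨fun h => H 0 (Nat.succ_lt_succ h), fun i h => H (i + 1) (Nat.succ_lt_succ h)⟩
      · rintro ⟨H₀, H⟩ i h
        cases i with
        | zero => exact H₀ (by omega)
        | succ i => exact H i (by omega)
    have key₀ (b : Fin n → ι) : (∀ h : 0 < n + 1, P ((Fin.cons x b : Fin (n + 1) → ι) ⟨0, h⟩)) ↔ P x :=
      ⟨fun H => H n.succ_pos, fun H _ => H⟩
    simp only [Fin.consEquiv_apply, key, key₀, Fin.prod_univ_succ, Fin.cons_zero, Fin.cons_succ,
      Fin.val_zero, Fin.val_succ, ite_and (P x), ← ih, Finset.mul_sum, mul_ite, mul_zero]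
    split_ifs <;> simp

theorem chainSum_congr_equiv {ι κ : Type*} [Fintype ι] [Fintype κ] (e : κ ≃ ι)
    (R : ι → ι → Prop) (n : ℕ) (f : ℕ → ι → ℂ) (P : ι → Prop) :
    chainSum R n f P =
      chainSum (fun x y => R (e x) (e y)) n (fun i x => f i (e x)) (fun x => P (e x)) := by
  induction n generalizing f P with
  | zero => rfl
  | succ n ih =>
    rw [chainSum, chainSum, ← e.sum_comp]
    simp only [ih]

theorem chainSum_sum_of_not_inl {α β : Type*} [Fintype α] [Fintype β]
    (R : α ⊕ β → α ⊕ β → Prop) (hR : ∀ x y, ¬ R (.inr y) (.inl x)) (n : ℕ)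
    (f : ℕ → α ⊕ β → ℂ) (P : α ⊕ β → Prop) (hP : ∀ x, ¬ P (.inl x)) :
    chainSum R n f P =
      chainSum (fun x y => R (.inr x) (.inr y)) n (fun i y => f i (.inr y))
        (fun y => P (.inr y)) := by
  induction n generalizing f P with
  | zero => rfl
  | succ n ih =>
    rw [chainSum, chainSum, Fintype.sum_sum_type]
    simp only [hP, if_false, Finset.sum_const_zero, zero_add]
    refine Finset.sum_congr rfl fun y _ => ?_
    rw [ih _ _ fun x => hR x y]

/-- If every element of `α` may precede every element of `β` but not conversely, then a chain
in `α ⊕ β` is a chain in `α` followed by a chain in `β`. -/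
theorem chainSum_sum {α β : Type*} [Fintype α] [Fintype β]
    (R : α ⊕ β → α ⊕ β → Prop) (hαβ : ∀ x y, R (.inl x) (.inr y))
    (hβα : ∀ x y, ¬ R (.inr y) (.inl x)) (n : ℕ)
    (f : ℕ → α ⊕ β → ℂ) (P : α ⊕ β → Prop) (hP : ∀ y, P (.inr y)) :
    chainSum R n f P = ∑ l ∈ Finset.range (n + 1),
      chainSum (fun x y => R (.inl x) (.inl y)) l (fun i x => f i (.inl x))
          (fun x => P (.inl x)) *
        chainSum (fun x y => R (.inr x) (.inr y)) (n - l) (fun i y => f (l + i) (.inr y))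
          (fun _ => True) := by
  induction n generalizing f P with
  | zero => simp [chainSum]
  | succ n ih =>
    rw [Finset.sum_range_succ']
    conv_lhs => rw [chainSum, Fintype.sum_sum_type]
    congr 1
    · simp only [Nat.add_sub_add_right, chainSum, Finset.sum_mul]
      rw [Finset.sum_comm]
      refine Finset.sum_congr rfl fun x _ => ?_
      split_ifs with h
      · rw [ih _ _ fun y => hαβ x y, Finset.mul_sum]
        refine Finset.sum_congr rfl fun l _ => ?_
        simp only [mul_assoc, Nat.add_right_comm l 1]
      · simp
    · simp only [Nat.sub_zero, chainSum, zero_add, one_mul, hP, if_true]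
      refine Finset.sum_congr rfl fun y _ => ?_
      rw [chainSum_sum_of_not_inl R hβα _ _ _ fun x => hβα x y]

theorem sum_filter_eq_chainSum_true {ι : Type*} [Fintype ι] (R : ι → ι → Prop) (n : ℕ)
    (f : ℕ → ι → ℂ) :
    ∑ b ∈ Finset.univ.filter (fun b : Fin n → ι =>
        ∀ (i : ℕ) (h : i + 1 < n), R (b ⟨i, by omega⟩) (b ⟨i + 1, h⟩)),
      ∏ i : Fin n, f i (b i) = chainSum R n f (fun _ => True) := by
  rw [← sum_filter_eq_chainSum, Finset.sum_filter]
  refine Finset.sum_congr rfl fun b _ => ?_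
  simp

theorem chainSum_mul_left {ι : Type*} [Fintype ι] (R : ι → ι → Prop) (n : ℕ) (c : ℂ)
    (f : ℕ → ι → ℂ) (P : ι → Prop) :
    chainSum R n (fun i x => c * f i x) P = c ^ n * chainSum R n f P := by
  induction n generalizing f P with
  | zero => simp [chainSum]
  | succ n ih =>
    simp only [chainSum, Finset.mul_sum, mul_ite, mul_zero, ih fun i => f (i + 1)]
    refine Finset.sum_congr rfl fun x _ => ?_
    split_ifs <;> ring

/-- A strictly increasing sequence in `Fin p` has at most `p` entries. -/
theorem chainSum_lt_eq_zero {p n : ℕ} (h : p < n) (f : ℕ → Fin p → ℂ) :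
    chainSum (fun x y : Fin p => (x : ℕ) < (y : ℕ)) n f (fun _ => True) = 0 := by
  rw [← sum_filter_eq_chainSum_true, Finset.sum_filter]
  refine Finset.sum_eq_zero fun b _ => if_neg fun hb => ?_
  have hmono : StrictMono b := by
    cases n with
    | zero => omega
    | succ n => exact Fin.strictMono_iff_lt_succ.2 fun i => hb i (by omega)
  have := Fintype.card_le_of_injective b hmono.injective
  simp only [Fintype.card_fin] at this
  omega

/-- The splitting of the index set `J` into `J₊` and `J₋`. -/
def splitEquiv (r s : ℕ) : Fin (r + 1) ⊕ Fin (s + 1) ≃ Fin (r + s + 2) :=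
  finSumFinEquiv.trans (finCongr (by omega))

@[simp]
theorem splitEquiv_inl_val (r s : ℕ) (x : Fin (r + 1)) :
    (splitEquiv r s (.inl x) : ℕ) = x := by
  simp [splitEquiv]

@[simp]
theorem splitEquiv_inr_val (r s : ℕ) (y : Fin (s + 1)) :
    (splitEquiv r s (.inr y) : ℕ) = y + r + 1 := by
  simp [splitEquiv]
  omega

theorem colSum_eq (r s : ℕ) (η : ℂ) (Nb : ℕ → ℕ) (rt : ℕ → ℕ → ℂ) (a : ℕ) (u : ℂ) :
    colSum r s η Nb rt 0 (fun _ => 0) a u =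
      ∑ l ∈ Finset.range (a + 1),
        Bdown r s η Nb rt (a - l) (u - (l : ℂ)) *
          Afun r s η Nb rt l (u + (a : ℂ) - (l : ℂ)) := by
  have h := sum_filter_eq_chainSum_true
    (fun x y : Fin (r + s + 2) =>
      (x : ℕ) ≤ (y : ℕ) ∧ ((x : ℕ) + 1 ≤ r + 1 → (x : ℕ) < (y : ℕ))) a
    (fun i x => sgn r ((x : ℕ) + 1) *
      zf r s η Nb rt 0 (fun _ => 0) ((x : ℕ) + 1) (u + (a : ℂ) + 1 - 2 * ((i : ℂ) + 1)))
  rw [chainSum_congr_equiv (splitEquiv r s), chainSum_sum _ _ _ _ _ _ fun _ => trivial] at h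
  · refine h.trans (Finset.sum_congr rfl fun l hl => ?_)
    have hla : l ≤ a := Nat.lt_succ_iff.1 (Finset.mem_range.1 hl)
    have hA := sum_filter_eq_chainSum_true (fun x y : Fin (r + 1) => (x : ℕ) < (y : ℕ)) l
      (fun i x => zf r s η Nb rt 0 (fun _ => 0) ((x : ℕ) + 1)
        (u + (a : ℂ) - (l : ℂ) + (l : ℂ) + 1 - 2 * ((i : ℂ) + 1)))
    have hB := sum_filter_eq_chainSum_true (fun x y : Fin (s + 1) => (x : ℕ) ≤ (y : ℕ)) (a - l)
      (fun i x => zf r s η Nb rt 0 (fun _ => 0) ((x : ℕ) + r + 2)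
        (u - (l : ℂ) + ((a - l : ℕ) : ℂ) + 1 - 2 * ((i : ℂ) + 1)))
    rw [Afun, Bdown, hA, hB, ← chainSum_mul_left, mul_comm]
    congr 2
    · funext x y
      simp only [splitEquiv_inr_val, eq_iff_iff]
      omega
    · funext i y
      simp only [splitEquiv_inr_val, sgn, Nat.cast_add, Nat.cast_sub hla]
      rw [if_neg (by omega)]
      congr 2
      ring
    · funext x y
      simp only [splitEquiv_inl_val, eq_iff_iff]
      omega
    · funext i x
      simp only [splitEquiv_inl_val, sgn]
      rw [if_pos (by omega), one_mul]
      congr 1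
      ring
  · intro x y
    simp only [splitEquiv_inl_val, splitEquiv_inr_val]
    omega
  · intro x y
    simp only [splitEquiv_inl_val, splitEquiv_inr_val]
    omega

theorem rowSum_eq (r s : ℕ) (η : ℂ) (Nb : ℕ → ℕ) (rt : ℕ → ℕ → ℂ) (m : ℕ) (u : ℂ) :
    rowSum r s η Nb rt 0 (fun _ => 0) m u =
      ∑ l ∈ Finset.range (m + 1),
        Adown r s η Nb rt (m - l) (u - (l : ℂ)) *
          Bup r s η Nb rt l (u + (m : ℂ) - (l : ℂ)) := by
  have h := sum_filter_eq_chainSum_true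
    (fun x y : Fin (r + s + 2) =>
      (x : ℕ) ≤ (y : ℕ) ∧ (r + 2 ≤ (x : ℕ) + 1 → (x : ℕ) < (y : ℕ))) m
    (fun i x => sgn r ((x : ℕ) + 1) *
      zf r s η Nb rt 0 (fun _ => 0) ((x : ℕ) + 1) (u - (m : ℂ) - 1 + 2 * ((i : ℂ) + 1)))
  rw [chainSum_congr_equiv (splitEquiv r s), chainSum_sum _ _ _ _ _ _ fun _ => trivial,
    ← Finset.sum_range_reflect] at h
  · refine h.trans (Finset.sum_congr rfl fun l hl => ?_)
    have hlm : l ≤ m := Nat.lt_succ_iff.1 (Finset.mem_range.1 hl)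
    have hA := sum_filter_eq_chainSum_true (fun x y : Fin (r + 1) => (x : ℕ) ≤ (y : ℕ)) (m - l)
      (fun i x => zf r s η Nb rt 0 (fun _ => 0) ((x : ℕ) + 1)
        (u - (l : ℂ) - ((m - l : ℕ) : ℂ) - 1 + 2 * ((i : ℂ) + 1)))
    have hB := sum_filter_eq_chainSum_true (fun x y : Fin (s + 1) => (x : ℕ) < (y : ℕ)) l
      (fun i x => zf r s η Nb rt 0 (fun _ => 0) ((x : ℕ) + r + 2)
        (u + (m : ℂ) - (l : ℂ) - (l : ℂ) - 1 + 2 * ((i : ℂ) + 1)))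
    rw [Adown, Bup, hA, hB, ← chainSum_mul_left, Nat.add_sub_cancel, Nat.sub_sub_self hlm]
    congr 2
    · funext x y
      simp only [splitEquiv_inl_val, eq_iff_iff]
      omega
    · funext i x
      simp only [splitEquiv_inl_val, sgn, Nat.cast_sub hlm]
      rw [if_pos (by omega), one_mul]
      congr 1
      ring
    · funext x y
      simp only [splitEquiv_inr_val, eq_iff_iff]
      omega
    · funext i y
      simp only [splitEquiv_inr_val, sgn, Nat.cast_add, Nat.cast_sub hlm]
      rw [if_neg (by omega)]
      congr 2
      ring
  · intro x y
    simp only [splitEquiv_inl_val, splitEquiv_inr_val]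
    omega
  · intro x y
    simp only [splitEquiv_inl_val, splitEquiv_inr_val]
    omega

theorem Afun_eq_zero (r s : ℕ) (η : ℂ) (Nb : ℕ → ℕ) (rt : ℕ → ℕ → ℂ) {l : ℕ}
    (hl : r + 1 < l) (v : ℂ) : Afun r s η Nb rt l v = 0 :=
  (sum_filter_eq_chainSum_true (fun x y : Fin (r + 1) => (x : ℕ) < (y : ℕ)) l
    (fun i x => zf r s η Nb rt 0 (fun _ => 0) ((x : ℕ) + 1)
      (v + (l : ℂ) + 1 - 2 * ((i : ℂ) + 1)))).trans (chainSum_lt_eq_zero hl _)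

theorem Bup_eq_zero (r s : ℕ) (η : ℂ) (Nb : ℕ → ℕ) (rt : ℕ → ℕ → ℂ) {l : ℕ}
    (hl : s + 1 < l) (v : ℂ) : Bup r s η Nb rt l v = 0 :=
  mul_eq_zero_of_right _ <|
    (sum_filter_eq_chainSum_true (fun x y : Fin (s + 1) => (x : ℕ) < (y : ℕ)) l
      (fun i x => zf r s η Nb rt 0 (fun _ => 0) ((x : ℕ) + r + 2)
        (v - (l : ℂ) - 1 + 2 * ((i : ℂ) + 1)))).trans (chainSum_lt_eq_zero hl _)

theorem sum_range_succ_eq_sum_range_min (p n : ℕ) (g : ℕ → ℂ) (hg : ∀ l, p < l → g l = 0) :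
    ∑ l ∈ Finset.range (n + 1), g l = ∑ l ∈ Finset.range (min p n + 1), g l := by
  symm
  apply Finset.sum_subset
  · intro l
    simp only [Finset.mem_range]
    omega
  · intro l hl hl'
    simp only [Finset.mem_range] at hl hl'
    exact hg l (by omega)

/-- With trivial vacuum (`N = 0`, so `P₁ ≡ 1`), for all
`a, m ≥ 1`:
`𝒯^a(u) = Σ_{l=0}^{min(r+1,a)} ℬ_{a−l}(u−l)𝒜^l(u+a−l)` and
`𝒯_m(u) = Σ_{l=0}^{min(s+1,m)} 𝒜_{m−l}(u−l)ℬ^l(u+m−l)`. -/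
theorem AB_decomposition
    (r s : ℕ) (η : ℂ) (hη : Complex.exp (2 * η) ≠ 1)
    (Nb : ℕ → ℕ) (rt : ℕ → ℕ → ℂ)
    (a m : ℕ) (ha : 1 ≤ a) (hm : 1 ≤ m) (u : ℂ) :
    (colSum r s η Nb rt 0 (fun _ => 0) a u =
      ∑ l ∈ Finset.range (min (r + 1) a + 1),
        Bdown r s η Nb rt (a - l) (u - (l : ℂ)) *
          Afun r s η Nb rt l (u + (a : ℂ) - (l : ℂ))) ∧
    (rowSum r s η Nb rt 0 (fun _ => 0) m u =
      ∑ l ∈ Finset.range (min (s + 1) m + 1),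
        Adown r s η Nb rt (m - l) (u - (l : ℂ)) *
          Bup r s η Nb rt l (u + (m : ℂ) - (l : ℂ))) := by
  constructor
  · rw [colSum_eq]
    exact sum_range_succ_eq_sum_range_min _ _ _ fun l hl => by
      rw [Afun_eq_zero r s η Nb rt hl, mul_zero]
  · rw [rowSum_eq]
    exact sum_range_succ_eq_sum_range_min _ _ _ fun l hl => by
      rw [Bup_eq_zero r s η Nb rt hl, mul_zero]

end Tsuboi
end
end
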